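/- There are no integers p, l, m, n, t such that |p| and n are prime numbers, m > 1, t > 0, |l| is prime, and 16·p^m + 1 = (l^t)^n. -/

import Mathlib

section

open Finset

theorem exists_submatrix_det_ne_zero {ι J F : Type*} [Fintype ι] [DecidableEq ι] [Fintype J]
    [Field F] (A : Matrix ι J F) (hA : ∀ v : ι → F, Matrix.vecMul v A = 0 → v = 0) :
    ∃ c : ι → J, Function.Injective c ∧ (A.submatrix id c).det ≠ 0 := by
  have hrow : LinearIndependent F A.row := by
    rw [Fintype.linearIndependent_iff]
    intro g hg i
    have : Matrix.vecMul g A = 0 := by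
      rw [← hg]; ext j; simp [Matrix.vecMul, dotProduct, Finset.sum_apply]
    exact congrFun (hA g this) i
  have hspan : Submodule.span F (Set.range A.col) = ⊤ := by
    apply Submodule.eq_top_of_finrank_eq
    rw [← Matrix.rank_eq_finrank_span_cols, hrow.rank_matrix, Module.finrank_fintype_fun_eq_card]
  obtain ⟨κ, a, ha, hsp, hli⟩ := exists_linearIndependent' F A.col
  rw [hspan] at hsp
  have : Finite κ := Finite.of_injective a ha
  have := Fintype.ofFinite κ
  have hcard : Fintype.card ι = Fintype.card κ := by
    have b := Module.Basis.mk hli hsp.ge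
    rw [← Module.finrank_fintype_fun_eq_card F (η := ι), Module.finrank_eq_card_basis b]
  obtain ⟨e⟩ := Fintype.card_eq.mp hcard
  refine ⟨a ∘ e, ha.comp e.injective, ?_⟩
  have hc : LinearIndependent F (A.submatrix id (a ∘ e)).col := hli.comp e e.injective
  rw [Matrix.linearIndependent_cols_iff_isUnit, Matrix.isUnit_iff_isUnit_det] at hc
  exact hc.ne_zero

open Polynomial in
theorem sum_eval_mul_pow_eq_zero {K L S T r : ℕ} {a y : ℚ} (hy : y ≠ 0) (ha : a ≠ 0)
    (hinj : Function.Injective fun l : ℕ => a ^ l)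
    (hT : T ≤ r) (hK : (K - 1) * L < T * (S - L + 1)) (hLS : L ≤ S) (P : Fin L → ℚ[X])
    (hdeg : ∀ l, (P l).natDegree ≤ K - 1)
    (hP : ∀ s < S, ∀ t < T, ∑ l, (P l).eval ((t + r * (S - 1 - s) : ℕ) : ℚ)
      * (y ^ t * a ^ s) ^ (l : ℕ) = 0) :
    P = 0 := by
  classical
  by_contra hne
  obtain ⟨l₀, hl₀⟩ : ∃ l, P l ≠ 0 := by
    by_contra h; push Not at h; exact hne (funext h)
  let A : Finset (Fin L) := Finset.univ.filter fun l => P l ≠ 0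
  let h := A.card
  have hh : h ≤ L := by simpa using A.card_le_univ
  have hpos : 0 < h := Finset.card_pos.mpr ⟨l₀, by simp [A, hl₀]⟩
  let e : Fin h ≃ A := A.equivFin.symm
  have heP : ∀ i, P (e i) ≠ 0 := fun i => (Finset.mem_filter.mp (e i).2).2
  let Q : Matrix (Fin h) (Fin h) ℚ[X] := fun i j =>
    C ((a ^ (e j : Fin L).val) ^ (i : ℕ)) * (P (e j)).comp (X - C ((r * i : ℕ) : ℚ))
  have hcomp : ∀ (i : ℕ) (p : ℚ[X]), (p.comp (X - C ((r * i : ℕ) : ℚ))).natDegree =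
      p.natDegree := by
    intro i p; rw [natDegree_comp, natDegree_X_sub_C, mul_one]
  have hlc : ∀ (i : ℕ) (p : ℚ[X]),
      (p.comp (X - C ((r * i : ℕ) : ℚ))).leadingCoeff = p.leadingCoeff := by
    intro i p
    rw [leadingCoeff_comp (by rw [natDegree_X_sub_C]; exact one_ne_zero), leadingCoeff_X_sub_C,
      one_pow, mul_one]
  have hQne : ∀ i j, Q i j ≠ 0 := by
    intro i j
    refine mul_ne_zero (C_ne_zero.mpr (by positivity)) fun h0 => heP j ?_
    rw [← leadingCoeff_eq_zero, ← hlc i, h0, leadingCoeff_zero]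
  have hQdeg : ∀ i j, (Q i j).natDegree = (P (e j)).natDegree := by
    intro i j
    rw [natDegree_C_mul (by positivity), hcomp]
  set d := ∑ j, (P (e j)).natDegree with hd
  have hdetdeg : Q.det.natDegree ≤ d := by
    rw [Matrix.det_apply]
    refine natDegree_sum_le_of_forall_le _ _ fun σ _ => ?_
    refine (natDegree_smul_le _ _).trans ?_
    rw [natDegree_prod _ _ fun i _ => hQne _ _]
    exact (Finset.sum_congr rfl fun i _ => hQdeg _ _).le
  have hcoeff : Q.det.coeff d =
      (Matrix.vandermonde fun j : Fin h => a ^ (e j : Fin L).val).det *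
        ∏ j, (P (e j)).leadingCoeff := by
    rw [← Matrix.det_transpose (Matrix.vandermonde _), Matrix.det_apply, Matrix.det_apply,
      finsetSum_coeff, Finset.sum_mul]
    refine Finset.sum_congr rfl fun σ _ => ?_
    rw [coeff_smul, smul_mul_assoc]
    congr 1
    have : (∏ i, Q (σ i) i).natDegree = d := by
      rw [natDegree_prod _ _ fun i _ => hQne _ _]
      exact Finset.sum_congr rfl fun i _ => hQdeg _ _
    rw [← this, coeff_natDegree, leadingCoeff_prod, ← Finset.prod_mul_distrib]
    refine Finset.prod_congr rfl fun i _ => ?_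
    simp only [Q, leadingCoeff_mul, leadingCoeff_C, hlc, Matrix.transpose_apply,
      Matrix.vandermonde_apply]
  have hdet : Q.det ≠ 0 := by
    intro h0
    rw [h0, coeff_zero] at hcoeff
    refine mul_ne_zero ?_ (Finset.prod_ne_zero_iff.mpr fun j _ => leadingCoeff_ne_zero.mpr (heP j))
      hcoeff.symm
    rw [Matrix.det_vandermonde_ne_zero_iff]
    intro i j hij
    exact e.injective (Subtype.ext (Fin.ext (hinj hij)))
  have hdle : d ≤ (K - 1) * L := by
    calc d ≤ ∑ _j : Fin h, (K - 1) := Finset.sum_le_sum fun j _ => hdeg _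
      _ = h * (K - 1) := by simp
      _ ≤ (K - 1) * L := by rw [mul_comm]; gcongr
  let Z : Finset (ℕ × ℕ) := Finset.range (S - L + 1) ×ˢ Finset.range T
  let f : ℕ × ℕ → ℚ := fun x => ((x.2 + r * (S - 1 - x.1) : ℕ) : ℚ)
  have hf : Set.InjOn f Z := by
    rintro ⟨s, t⟩ h1 ⟨s', t'⟩ h2 h12
    simp only [Z, Finset.coe_product, Finset.coe_range, Set.mem_prod, Set.mem_Iio] at h1 h2
    have h12' : t + r * (S - 1 - s) = t' + r * (S - 1 - s') := Nat.cast_injective (R := ℚ) h12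
    have hr : 0 < r := by omega
    have ht : t = t' := by
      have := congrArg (· % r) h12'
      simpa [Nat.mod_eq_of_lt (h1.2.trans_le hT), Nat.mod_eq_of_lt (h2.2.trans_le hT)] using this
    subst ht
    have := Nat.eq_of_mul_eq_mul_left hr (Nat.add_left_cancel h12')
    simp only [Prod.mk.injEq, and_true]; omega
  refine hdet (eq_zero_of_natDegree_lt_card_of_eval_eq_zero' _ (Z.image f) ?_ ?_)
  · intro x hx
    obtain ⟨⟨s, t⟩, hst, rfl⟩ := Finset.mem_image.mp hx
    simp only [Z, Finset.mem_product, Finset.mem_range] at hst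
    rw [← coe_evalRingHom, RingHom.map_det, ← Matrix.exists_mulVec_eq_zero_iff]
    refine ⟨fun j => (y ^ t * a ^ s) ^ (e j : Fin L).val, ?_, ?_⟩
    · intro h0
      have := congrFun h0 ⟨0, hpos⟩
      simp [hy, ha] at this
    · ext i
      have hi : (i : ℕ) < L := i.2.trans_le hh
      have key := hP (s + i) (by omega) t hst.2
      have hw : ((t + r * (S - 1 - (s + i)) : ℕ) : ℚ) = f (s, t) - ((r * i : ℕ) : ℚ) := by
        have : S - 1 - s = (S - 1 - (s + i)) + i := by omega
        simp only [f, this]; push_cast; ring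
      rw [hw] at key
      rw [← Finset.sum_subset (Finset.subset_univ A)] at key
      · rw [← Finset.sum_coe_sort A, ← Equiv.sum_comp e] at key
        rw [Pi.zero_apply, ← key, Matrix.mulVec, dotProduct]
        refine Finset.sum_congr rfl fun j _ => ?_
        have hQ : (evalRingHom (f (s, t))).mapMatrix Q i j =
            (a ^ (e j : Fin L).val) ^ (i : ℕ) *
              (P (e j)).eval (f (s, t) - ((r * i : ℕ) : ℚ)) := by
          change (Q i j).eval (f (s, t)) = _
          simp only [Q, eval_mul, eval_C, eval_comp, eval_sub, eval_X]
        rw [hQ, pow_add, ← mul_assoc, mul_pow _ (a ^ (i : ℕ)), ← pow_mul a (i : ℕ),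
          mul_comm (i : ℕ), pow_mul]
        ring
      · intro l _ hl
        have : P l = 0 := by simpa [A] using hl
        simp [this]
  · rw [Finset.card_image_of_injOn hf]
    simp only [Z, Finset.card_product, Finset.card_range]
    calc Q.det.natDegree ≤ (K - 1) * L := hdetdeg.trans hdle
      _ < _ := by rw [mul_comm (S - L + 1)]; exact hK

theorem sum_range_le_sum_of_fiber_card_le_one {ι : Type*} [Fintype ι] (f : ι → ℕ)
    (hf : ∀ m < Fintype.card ι, (univ.filter fun i => f i = m).card ≤ 1) :
    ∑ m ∈ range (Fintype.card ι), m ≤ ∑ i, f i := by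
  classical
  set N := Fintype.card ι
  have h1 : ∀ i, (range N).sum (fun v => if v < f i then 1 else 0) ≤ f i := by
    intro i
    rw [← card_filter]
    calc _ ≤ (range (f i)).card := card_le_card fun v hv => by simp at hv ⊢; exact hv.2
      _ = f i := card_range _
  have h2 : ∀ v < N, (univ.filter fun i => ¬ v < f i).card ≤ v + 1 := by
    intro v hv
    calc (univ.filter fun i => ¬ v < f i).card
        ≤ ((range (v + 1)).biUnion fun m => univ.filter fun i => f i = m).card := by
          refine card_le_card fun i hi => ?_
          simp at hi ⊢; omega
      _ ≤ (range (v + 1)).card * 1 := card_biUnion_le_card_mul _ _ _ fun m hm => hf m (by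
          simp at hm; omega)
      _ = v + 1 := by simp
  calc ∑ m ∈ range N, m = ∑ v ∈ range N, (N - 1 - v) := by
        rw [sum_range_reflect (fun m => m)]
    _ ≤ ∑ v ∈ range N, ∑ i, (if v < f i then 1 else 0) := by
        refine sum_le_sum fun v hv => ?_
        rw [← card_filter]
        have := card_filter_add_card_filter_not (s := (univ : Finset ι)) (fun i => v < f i)
        have h3 := h2 v (mem_range.mp hv)
        have h4 : (univ : Finset ι).card = N := rfl
        omega
    _ = ∑ i, ∑ v ∈ range N, (if v < f i then 1 else 0) := sum_comm
    _ ≤ ∑ i, f i := sum_le_sum fun i _ => h1 i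

theorem pow_sum_range_dvd_det {ι : Type*} [Fintype ι] [DecidableEq ι] (p : ℤ)
    (M E : Matrix ι ι ℤ) (U : ι → ℕ → ℤ) (B : ℕ → ι → ℤ)
    (hM : ∀ i c, M i c = ∑ m ∈ range (Fintype.card ι), p ^ m * U i m * B m c +
      p ^ Fintype.card ι * E i c) :
    p ^ (∑ m ∈ range (Fintype.card ι), m) ∣ M.det := by
  classical
  set N := Fintype.card ι
  let J := Fin N ⊕ Unit
  let wt : J → ℕ := Sum.elim (fun m => m) (fun _ => N)
  let co : ι → J → ℤ := fun i => Sum.elim (fun m => U i m) (fun _ => 1)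
  let ro : ι → J → ι → ℤ := fun i => Sum.elim (fun m => B m) (fun _ => E i)
  have hrow : M = fun i => ∑ j : J, (p ^ wt j * co i j) • ro i j := by
    ext i c
    rw [hM, Finset.sum_apply, Fintype.sum_sum_type]
    simp [wt, co, ro, Finset.sum_range]
  have hdet : M.det = ∑ f : ι → J, Matrix.detRowAlternating
      (fun i => (p ^ wt (f i) * co i (f i)) • ro i (f i)) := by
    conv_lhs => rw [hrow]
    exact (Matrix.detRowAlternating (n := ι) (R := ℤ)).toMultilinearMap.map_sum
      fun i j => (p ^ wt j * co i j) • ro i j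
  rw [hdet]
  refine dvd_sum fun f _ => ?_
  by_cases hf : ∃ i i' : ι, i ≠ i' ∧ f i = f i' ∧ wt (f i) < N
  · obtain ⟨i, i', hne, hii, hlt⟩ := hf
    have : (Matrix.detRowAlternating (fun i => (p ^ wt (f i) * co i (f i)) • ro i (f i)) : ℤ) =
        (∏ i, (p ^ wt (f i) * co i (f i))) • Matrix.detRowAlternating fun i => ro i (f i) :=
      (Matrix.detRowAlternating (n := ι) (R := ℤ)).toMultilinearMap.map_smul_univ _ _
    rw [this, (Matrix.detRowAlternating (n := ι) (R := ℤ)).map_eq_zero_of_eq _ _ hne, smul_zero]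
    · exact dvd_zero _
    · show ro i (f i) = ro i' (f i')
      rw [← hii]
      rcases hfi : f i with m | u
      · rfl
      · rw [hfi] at hlt; exact absurd hlt (lt_irrefl N)
  · push Not at hf
    have hs := sum_range_le_sum_of_fiber_card_le_one (fun i => wt (f i)) fun m hm => by
      rw [card_le_one]
      intro i hi i' hi'
      simp only [mem_filter, mem_univ, true_and] at hi hi'
      by_contra hne
      have hlt : wt (f i) < N := by omega
      refine absurd hlt (not_lt.mpr (hf i i' hne ?_))
      rcases hfi : f i with x | x <;> rcases hfi' : f i' with z | z <;> rw [hfi] at hi hlt <;>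
        rw [hfi'] at hi'
      · have : x = z := Fin.ext (by simpa [wt] using hi.trans hi'.symm)
        rw [this]
      · exfalso; have : wt (Sum.inr z) = N := rfl
        omega
      · exact absurd hlt (lt_irrefl N)
    have : (Matrix.detRowAlternating (fun i => (p ^ wt (f i) * co i (f i)) • ro i (f i)) : ℤ) =
        (∏ i, (p ^ wt (f i) * co i (f i))) • Matrix.detRowAlternating fun i => ro i (f i) :=
      (Matrix.detRowAlternating (n := ι) (R := ℤ)).toMultilinearMap.map_smul_univ _ _
    rw [this, prod_mul_distrib, prod_pow_eq_pow_sum, smul_eq_mul, mul_assoc]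
    exact (pow_dvd_pow p hs).mul_right _

theorem choose_mul_pow_eq_sum {R : Type*} [CommRing R] (x : R) (k w : ℕ) :
    (w.choose k : R) * (1 + x) ^ w =
      ∑ m ∈ range (w + 1), (w.choose m : R) * (m.choose k * x ^ (m - k) * (1 + x) ^ k) := by
  rcases lt_or_ge w k with h | h
  · rw [Nat.choose_eq_zero_of_lt h, Nat.cast_zero, zero_mul]
    refine (sum_eq_zero fun m hm => ?_).symm
    rw [Nat.choose_eq_zero_of_lt (by simp at hm; omega : m < k)]
    simp
  · obtain ⟨d, rfl⟩ := Nat.exists_eq_add_of_le h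
    rw [add_assoc, sum_range_add, sum_eq_zero, zero_add, pow_add, add_comm (1 : R) x,
      add_pow x 1 d, mul_sum, mul_sum]
    · refine sum_congr rfl fun m hm => ?_
      have h1 := Nat.choose_mul (n := k + d) (k := k + m) (s := k) (by omega)
      have h2 : ((k + d).choose (k + m) : R) * (k + m).choose k =
          (k + d).choose k * d.choose m := by
        have e1 : k + d - k = d := by omega
        have e2 : k + m - k = m := by omega
        rw [e1, e2] at h1
        rw [← Nat.cast_mul, ← Nat.cast_mul, h1]
      rw [show k + m - k = m by omega]
      linear_combination (-(x ^ m * (x + 1) ^ k)) * h2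
    · intro m hm
      rw [Nat.choose_eq_zero_of_lt (by simp at hm; omega : m < k)]
      simp

/-- The interpolation matrix whose `(k, l)` row is the function `C(w, k) (y ^ t a ^ s) ^ l`
evaluated at the points `(s, t)` with `w = t + r (S - 1 - s)`. -/
def interpolationMatrix (K L S r : ℕ) (a y : ℤ) (c : Fin K × Fin L → ℕ × ℕ) :
    Matrix (Fin K × Fin L) (Fin K × Fin L) ℤ := fun i x =>
  (((c x).2 + r * (S - 1 - (c x).1)).choose i.1 : ℤ) * (y ^ (c x).2 * a ^ (c x).1) ^ (i.2 : ℕ)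

theorem pow_dvd_det_interpolationMatrix {K L S r n : ℕ} {p a y : ℤ} (hp : Prime p)
    (hy : p ∣ y - 1) (hay : a * y ^ r = 1 - p ^ n) (hn : K * L ≤ n)
    (c : Fin K × Fin L → ℕ × ℕ) (hc : ∀ x, (c x).1 < S) :
    p ^ (K ^ 2 * ∑ l ∈ range L, l) ∣ (interpolationMatrix K L S r a y c).det := by
  set M := interpolationMatrix K L S r a y c with hMdef
  have hcard : Fintype.card (Fin K × Fin L) = K * L := by simp
  let v : Fin K × Fin L → ℤ := fun i => p ^ (i.1 : ℕ) * y ^ ((i.2 : ℕ) * (r * (S - 1)))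
  have hx : ∀ l : ℕ, ∃ x, y ^ l = 1 + p * x := by
    intro l
    obtain ⟨x, hx⟩ := hy.trans (sub_one_dvd_pow_sub_one y l)
    exact ⟨x, by linarith⟩
  choose x hx using hx
  have hz : ∀ e : ℕ, ∃ z, (1 - p ^ n) ^ e = 1 + p ^ (K * L) * z := by
    intro e
    have h1 : p ^ (K * L) ∣ (1 - p ^ n) - 1 := by
      rw [sub_sub_cancel_left]; exact (pow_dvd_pow p hn).neg_right
    obtain ⟨x, hx⟩ := h1.trans (sub_one_dvd_pow_sub_one _ e)
    exact ⟨x, by linarith⟩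
  choose z hz using hz
  let w : Fin K × Fin L → ℕ := fun j => (c j).2 + r * (S - 1 - (c j).1)
  let U : Fin K × Fin L → ℕ → ℤ := fun i m =>
    m.choose i.1 * x i.2 ^ (m - i.1) * (1 + p * x i.2) ^ (i.1 : ℕ)
  have hU : ∀ i m, (m.choose (i.1 : ℕ) : ℤ) * (p * x i.2) ^ (m - (i.1 : ℕ)) * p ^ (i.1 : ℕ) *
      (1 + p * x i.2) ^ (i.1 : ℕ) = p ^ m * U i m := by
    intro i m
    rcases lt_or_ge m (i.1 : ℕ) with h | h
    · simp [U, Nat.choose_eq_zero_of_lt h]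
    · obtain ⟨d, rfl⟩ := Nat.exists_eq_add_of_le h
      simp only [U, Nat.add_sub_cancel_left, mul_pow, pow_add]; ring
  have hrow : ∀ i j, v i * M i j = p ^ (i.1 : ℕ) * ((w j).choose i.1 : ℤ) *
      (1 + p * x i.2) ^ w j * (1 + p ^ (K * L) * z (i.2 * (c j).1)) := by
    intro i j
    have hs := hc j
    have e1 : r * (S - 1) = r * (S - 1 - (c j).1) + r * (c j).1 := by
      rw [← mul_add]; congr 1; omega
    rw [← hx, ← hz, ← hay]
    simp only [v, M, interpolationMatrix, w, e1, mul_pow, ← pow_mul]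
    ring
  have hsum : ∀ i j, ∃ e, v i * M i j =
      ∑ m ∈ range (K * L), p ^ m * U i m * ((w j).choose m : ℤ) + p ^ (K * L) * e := by
    intro i j
    rw [hrow, mul_add, mul_one, mul_assoc (p ^ (i.1 : ℕ)), choose_mul_pow_eq_sum, mul_sum]
    have h1 : ∀ m, p ^ (i.1 : ℕ) * (((w j).choose m : ℤ) * ((m.choose (i.1 : ℕ) : ℤ) *
        (p * x i.2) ^ (m - (i.1 : ℕ)) * (1 + p * x i.2) ^ (i.1 : ℕ))) =
        p ^ m * U i m * ((w j).choose m : ℤ) := by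
      intro m; rw [← hU]; ring
    simp only [h1]
    have h2 : ∑ m ∈ range (w j + 1), p ^ m * U i m * ((w j).choose m : ℤ) =
        ∑ m ∈ range (w j + 1 + K * L), p ^ m * U i m * ((w j).choose m : ℤ) := by
      rw [sum_range_add _ (w j + 1), left_eq_add]
      refine sum_eq_zero fun m _ => ?_
      rw [Nat.choose_eq_zero_of_lt (by omega)]; simp
    have h3 : ∑ m ∈ range (w j + 1), p ^ m * U i m * ((w j).choose m : ℤ) =
        ∑ m ∈ range (K * L), p ^ m * U i m * ((w j).choose m : ℤ) +
          p ^ (K * L) * ∑ m ∈ range (w j + 1), p ^ m * U i (K * L + m) *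
            ((w j).choose (K * L + m) : ℤ) := by
      rw [h2, add_comm (w j + 1), sum_range_add, mul_sum]
      congr 1
      refine sum_congr rfl fun m _ => ?_
      rw [pow_add]; ring
    refine ⟨∑ m ∈ range (w j + 1), p ^ m * U i (K * L + m) * ((w j).choose (K * L + m) : ℤ) +
      (∑ m ∈ range (w j + 1), p ^ m * U i m * ((w j).choose m : ℤ)) * z (i.2 * (c j).1), ?_⟩
    rw [mul_add, ← add_assoc, ← h3]; ring
  choose E hE using hsum
  have hdvd := pow_sum_range_dvd_det p (Matrix.of fun i j => v i * M i j) (fun i j => E i j) U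
    (fun m j => ((w j).choose m : ℤ)) (by rw [hcard]; exact hE)
  rw [Matrix.det_mul_column, hcard] at hdvd
  have hgauss : ∑ m ∈ range (K * L), m = L * ∑ k ∈ range K, k + K ^ 2 * ∑ l ∈ range L, l := by
    have h1 := sum_range_id_mul_two (K * L)
    have h2 := sum_range_id_mul_two K
    have h3 := sum_range_id_mul_two L
    rcases Nat.eq_zero_or_pos K with rfl | hK
    · simp
    rcases Nat.eq_zero_or_pos L with rfl | hL
    · simp
    have hKL : 1 ≤ K * L := Nat.mul_pos hK hL
    zify [hK, hL, hKL] at h1 h2 h3 ⊢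
    linarith [show (K * L : ℤ) * (K * L - 1) = L * (K * (K - 1)) + K ^ 2 * (L * (L - 1)) by ring,
      show (L : ℤ) * ((∑ k ∈ range K, (k : ℤ)) * 2) = L * (K * (K - 1)) from congrArg _ h2,
      show (K : ℤ) ^ 2 * ((∑ l ∈ range L, (l : ℤ)) * 2) = K ^ 2 * (L * (L - 1)) from
        congrArg _ h3]
  have hv : ∏ i, v i = p ^ (L * ∑ k ∈ range K, k) *
      y ^ (∑ i : Fin K × Fin L, (i.2 : ℕ) * (r * (S - 1))) := by
    simp only [v]
    rw [prod_mul_distrib, prod_pow_eq_pow_sum, prod_pow_eq_pow_sum]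
    congr 2
    rw [Fintype.sum_prod_type, Finset.sum_range]
    simp [mul_sum]
  rw [hgauss, pow_add, hv, mul_assoc] at hdvd
  have h4 := (mul_dvd_mul_iff_left (pow_ne_zero _ hp.ne_zero)).mp hdvd
  refine (IsCoprime.pow (hp.coprime_iff_not_dvd.mpr fun h => ?_)).dvd_of_dvd_mul_left h4
  have := dvd_sub h hy
  rw [sub_sub_cancel] at this
  exact hp.not_isUnit (isUnit_of_dvd_one this)

theorem det_choose_mul_eq_det_pow_mul {K L : ℕ} (c : ℝ) (w : Fin K × Fin L → ℕ)
    (g : Fin L → Fin K × Fin L → ℝ) :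
    (Matrix.of fun i j : Fin K × Fin L => ((w j).choose i.1 : ℝ) * g i.2 j).det =
      (Matrix.of fun i j : Fin K × Fin L =>
        ((w j : ℝ) - c) ^ (i.1 : ℕ) / (i.1 : ℕ).factorial * g i.2 j).det := by
  let q : ℕ → Polynomial ℝ := fun k => (descPochhammer ℝ k).comp (Polynomial.X + Polynomial.C c)
  have hmon : ∀ k, (q k).Monic := fun k =>
    (monic_descPochhammer ℝ k).comp_X_add_C c
  have hdeg : ∀ k, (q k).natDegree = k := by
    intro k
    simp only [q]
    rw [Polynomial.natDegree_comp, Polynomial.natDegree_X_add_C, mul_one,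
      descPochhammer_natDegree]
  let τ : Matrix (Fin K) (Fin K) ℝ := Matrix.of fun k k' =>
    (q k).coeff k' * (k' : ℕ).factorial / (k : ℕ).factorial
  have hτ : τ.det = 1 := by
    rw [Matrix.det_of_isLowerTriangular]
    · refine prod_eq_one fun k _ => ?_
      have : (q k).coeff k = 1 := by
        have := (hmon k).coeff_natDegree; rwa [hdeg] at this
      simp only [τ, Matrix.of_apply, this, one_mul]
      exact div_self (by positivity)
    · intro k k' hkk
      have hkk' : (k : ℕ) < k' := hkk
      simp only [τ, Matrix.of_apply]
      rw [Polynomial.coeff_eq_zero_of_natDegree_lt (by rw [hdeg]; exact hkk'), zero_mul, zero_div]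
  have hchoose : ∀ (v : ℕ) (k : Fin K), (v.choose k : ℝ) =
      ∑ k' : Fin K, τ k k' * (((v : ℝ) - c) ^ (k' : ℕ) / (k' : ℕ).factorial) := by
    intro v k
    have h1 : (q k).eval ((v : ℝ) - c) = (k : ℕ).factorial * (v.choose k : ℝ) := by
      simp only [q, Polynomial.eval_comp, Polynomial.eval_add, Polynomial.eval_X,
        Polynomial.eval_C, sub_add_cancel]
      rw [descPochhammer_eval_eq_descFactorial, Nat.descFactorial_eq_factorial_mul_choose,
        Nat.cast_mul]
    rw [Polynomial.eval_eq_sum_range' (n := K) (by rw [hdeg]; exact k.2), Finset.sum_range] at h1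
    have h2 : ((k : ℕ).factorial : ℝ) ≠ 0 := by positivity
    rw [eq_comm, ← mul_right_inj' h2, ← h1, mul_sum]
    refine sum_congr rfl fun k' _ => ?_
    simp only [τ, Matrix.of_apply]
    field_simp
  have hmul : (Matrix.of fun i j : Fin K × Fin L => ((w j).choose i.1 : ℝ) * g i.2 j) =
      Matrix.kroneckerMap (fun x z => x * z) τ (1 : Matrix (Fin L) (Fin L) ℝ) *
      (Matrix.of fun i j : Fin K × Fin L =>
        ((w j : ℝ) - c) ^ (i.1 : ℕ) / (i.1 : ℕ).factorial * g i.2 j) := by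
    ext i j
    rw [Matrix.mul_apply, Fintype.sum_prod_type]
    simp only [Matrix.of_apply, Matrix.kroneckerMap_apply, Matrix.one_apply, hchoose (w j) i.1,
      sum_mul, mul_ite, mul_one, mul_zero, ite_mul, zero_mul, sum_ite_eq, mem_univ, if_true]
    exact sum_congr rfl fun k _ => by ring
  rw [hmul, Matrix.det_mul]
  have := Matrix.det_kronecker τ (1 : Matrix (Fin L) (Fin L) ℝ)
  rw [hτ, Matrix.det_one, one_pow, one_pow, one_mul] at this
  rw [show (Matrix.kroneckerMap (fun x z => x * z) τ (1 : Matrix (Fin L) (Fin L) ℝ)).det = 1 from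
    this, one_mul]

/-- Every Leibniz term of the interpolation determinant has the same powers of `y` and `b` up to
the spreads `δ` and `δ'`. -/
theorem pow_mul_log_le_of_interpolation {K L S T r n p b : ℕ} {y : ℕ} (hp : p.Prime)
    (hy : (p : ℤ) ∣ y - 1) (hb : p.Coprime b) (hb1 : 1 < b) (hy1 : 1 < y)
    (hay : (-b : ℤ) * y ^ r = 1 - p ^ n) (hn : K * L ≤ n) (hR : 0 < r * (S - 1) + T - 1)
    (c : Fin K × Fin L → ℕ × ℕ) (hcS : ∀ x, (c x).1 < S) (hcT : ∀ x, (c x).2 < T)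
    (hdet : (interpolationMatrix K L S r (-b) y c).det ≠ 0) (δ δ' : ℝ)
    (hδ : ∀ σ τ : Equiv.Perm (Fin K × Fin L), (∑ i, ((σ i).2 : ℝ) * (c i).2) ≤
      (∑ i, ((τ i).2 : ℝ) * (c i).2) + δ)
    (hδ' : ∀ σ τ : Equiv.Perm (Fin K × Fin L), (∑ i, ((σ i).2 : ℝ) * (c i).1) ≤
      (∑ i, ((τ i).2 : ℝ) * (c i).1) + δ') :
    (K ^ 2 * ∑ l ∈ range L, l : ℕ) * Real.log p ≤ Real.log (K * L).factorial +
      L * ∑ k ∈ range K, (k * Real.log ((r * (S - 1) + T - 1 : ℕ) / 2) - Real.log k.factorial) +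
      δ * Real.log y + δ' * Real.log b := by
  classical
  set M := interpolationMatrix K L S r (-b) y c with hM
  set R : ℕ := r * (S - 1) + T - 1 with hRdef
  let w : Fin K × Fin L → ℕ := fun j => (c j).2 + r * (S - 1 - (c j).1)
  let e : Equiv.Perm (Fin K × Fin L) → ℕ := fun σ => ∑ i, ((σ i).2 : ℕ) * (c i).2
  let e' : Equiv.Perm (Fin K × Fin L) → ℕ := fun σ => ∑ i, ((σ i).2 : ℕ) * (c i).1
  obtain ⟨σ₀, -, hσ₀⟩ := exists_min_image (univ : Finset (Equiv.Perm (Fin K × Fin L))) e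
    ⟨1, mem_univ _⟩
  obtain ⟨σ₁, -, hσ₁⟩ := exists_min_image (univ : Finset (Equiv.Perm (Fin K × Fin L))) e'
    ⟨1, mem_univ _⟩
  have hpZ : Prime (p : ℤ) := Nat.prime_iff_prime_int.mp hp
  have hterm : ∀ σ : Equiv.Perm (Fin K × Fin L), ∏ i, M (σ i) i =
      (∏ i, ((w i).choose (σ i).1 : ℤ)) * ((y : ℤ) ^ e σ * (-b : ℤ) ^ e' σ) := by
    intro σ
    simp only [hM, interpolationMatrix, e, e', w]
    rw [← prod_pow_eq_pow_sum, ← prod_pow_eq_pow_sum, ← prod_mul_distrib, ← prod_mul_distrib]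
    refine prod_congr rfl fun i _ => ?_
    rw [mul_pow, ← pow_mul, ← pow_mul, mul_comm (c i).2, mul_comm (c i).1]
  have hd1 : (y : ℤ) ^ e σ₀ * (-b : ℤ) ^ e' σ₁ ∣ M.det := by
    rw [Matrix.det_apply]
    refine dvd_sum fun σ _ => ?_
    rw [Units.smul_def, hterm]
    refine Dvd.dvd.mul_left (Dvd.dvd.mul_left ?_ _) _
    exact mul_dvd_mul (pow_dvd_pow _ (hσ₀ σ (mem_univ _))) (pow_dvd_pow _ (hσ₁ σ (mem_univ _)))
  have hd2 : (p : ℤ) ^ (K ^ 2 * ∑ l ∈ range L, l) ∣ M.det :=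
    pow_dvd_det_interpolationMatrix hpZ hy hay hn c hcS
  have hcop : IsCoprime ((p : ℤ) ^ (K ^ 2 * ∑ l ∈ range L, l))
      ((y : ℤ) ^ e σ₀ * (-b : ℤ) ^ e' σ₁) := by
    refine IsCoprime.mul_right (IsCoprime.pow ?_) (IsCoprime.pow ?_)
    · rw [hpZ.coprime_iff_not_dvd]
      intro h
      have := dvd_sub h hy
      rw [sub_sub_cancel] at this
      exact hpZ.not_isUnit (isUnit_of_dvd_one this)
    · exact (Nat.isCoprime_iff_coprime.mpr hb).neg_right
  have hlow := Int.le_of_dvd (abs_pos.mpr hdet) ((dvd_abs _ _).mpr ((abs_dvd _ _).mpr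
    (hcop.mul_dvd hd2 hd1)))
  have hlow' : (p : ℝ) ^ (K ^ 2 * ∑ l ∈ range L, l) * ((y : ℝ) ^ e σ₀ * (b : ℝ) ^ e' σ₁) ≤
      |(M.det : ℝ)| := by
    have h1 : |(p : ℤ) ^ (K ^ 2 * ∑ l ∈ range L, l) * ((y : ℤ) ^ e σ₀ * (-b : ℤ) ^ e' σ₁)| =
        (p : ℤ) ^ (K ^ 2 * ∑ l ∈ range L, l) * ((y : ℤ) ^ e σ₀ * (b : ℤ) ^ e' σ₁) := by
      rw [abs_mul, abs_mul, abs_pow, abs_pow, abs_pow, abs_neg, Nat.abs_cast, Nat.abs_cast,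
        Nat.abs_cast]
    rw [h1] at hlow
    exact_mod_cast hlow
  let f : ℕ → ℝ := fun k => ((R : ℝ) / 2) ^ k / k.factorial
  have hR0 : (0 : ℝ) < (R : ℝ) / 2 := by positivity
  have hf0 : ∀ k, 0 < f k := fun k => by simp only [f]; positivity
  have hcast : (M.det : ℝ) = (Matrix.of fun i j : Fin K × Fin L =>
      ((w j : ℝ) - (R : ℝ) / 2) ^ (i.1 : ℕ) / (i.1 : ℕ).factorial *
        ((y : ℝ) ^ (c j).2 * (-b : ℝ) ^ (c j).1) ^ (i.2 : ℕ)).det := by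
    rw [← det_choose_mul_eq_det_pow_mul ((R : ℝ) / 2) w
      (fun l j => ((y : ℝ) ^ (c j).2 * (-b : ℝ) ^ (c j).1) ^ (l : ℕ))]
    change Int.castRingHom ℝ M.det = _
    rw [RingHom.map_det]
    congr 1
    ext i j
    simp [hM, interpolationMatrix, w]
  have hw : ∀ j, |(w j : ℝ) - (R : ℝ) / 2| ≤ (R : ℝ) / 2 := by
    intro j
    have h1 : w j ≤ R := by
      have h2 : r * (S - 1 - (c j).1) ≤ r * (S - 1) := Nat.mul_le_mul_left _ (Nat.sub_le _ _)
      have h3 := hcT j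
      simp only [w, hRdef]
      omega
    have h2 : (w j : ℝ) ≤ R := by exact_mod_cast h1
    have h3 : (0 : ℝ) ≤ w j := by positivity
    rw [abs_le]; constructor <;> linarith
  have hylog : 0 < Real.log y := Real.log_pos (by exact_mod_cast hy1)
  have hblog : 0 < Real.log b := Real.log_pos (by exact_mod_cast hb1)
  have hy0 : (0 : ℝ) < y := by positivity
  have hb0 : (0 : ℝ) < b := by positivity
  set B : ℝ := (∏ k : Fin K, f k) ^ L * (((y : ℝ) ^ e σ₀ * (b : ℝ) ^ e' σ₁) *
    Real.exp (δ * Real.log y + δ' * Real.log b)) with hB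
  have hup : |(M.det : ℝ)| ≤ (K * L).factorial * B := by
    rw [hcast, Matrix.det_apply]
    refine (abs_sum_le_sum_abs _ _).trans ?_
    have hcardP : (K * L).factorial = (univ : Finset (Equiv.Perm (Fin K × Fin L))).card := by
      rw [Finset.card_univ, Fintype.card_perm]; simp
    rw [hcardP, ← nsmul_eq_mul]
    refine sum_le_card_nsmul _ _ _ fun σ _ => ?_
    have h1 : ∀ x : ℝ, |Equiv.Perm.sign σ • x| = |x| := by
      intro x
      rcases Int.units_eq_one_or (Equiv.Perm.sign σ) with h | h <;> simp [h]
    rw [h1, abs_prod]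
    have h2 : ∀ i, |(Matrix.of fun i j : Fin K × Fin L =>
        ((w j : ℝ) - (R : ℝ) / 2) ^ (i.1 : ℕ) / (i.1 : ℕ).factorial *
        ((y : ℝ) ^ (c j).2 * (-b : ℝ) ^ (c j).1) ^ (i.2 : ℕ)) (σ i) i| ≤
        f (σ i).1 * ((y : ℝ) ^ (((σ i).2 : ℕ) * (c i).2) *
          (b : ℝ) ^ (((σ i).2 : ℕ) * (c i).1)) := by
      intro i
      rw [Matrix.of_apply, abs_mul, abs_div, abs_pow, abs_pow, abs_mul, abs_pow, abs_pow, abs_neg,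
        Nat.abs_cast, Nat.abs_cast, Nat.abs_cast, mul_pow, ← pow_mul, ← pow_mul,
        mul_comm (c i).2, mul_comm (c i).1]
      have := hw i
      simp only [f]
      gcongr
    refine (prod_le_prod (fun i _ => abs_nonneg _) fun i _ => h2 i).trans ?_
    rw [prod_mul_distrib, prod_mul_distrib, prod_pow_eq_pow_sum, prod_pow_eq_pow_sum]
    have h3 : ∏ i, f (σ i).1 = (∏ k : Fin K, f k) ^ L := by
      rw [Equiv.prod_comp σ (fun i => f i.1), Fintype.prod_prod_type]
      simp [prod_pow]
    rw [h3, hB]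
    refine mul_le_mul_of_nonneg_left ?_ (pow_nonneg (prod_nonneg fun k _ => (hf0 _).le) _)
    rw [← Real.exp_log (show 0 < (y : ℝ) ^ (∑ i, ((σ i).2 : ℕ) * (c i).2) *
        (b : ℝ) ^ (∑ i, ((σ i).2 : ℕ) * (c i).1) by positivity),
      ← Real.exp_log (show 0 < (y : ℝ) ^ e σ₀ * (b : ℝ) ^ e' σ₁ by positivity), ← Real.exp_add,
      Real.exp_le_exp, Real.log_mul (by positivity) (by positivity),
      Real.log_mul (by positivity) (by positivity), Real.log_pow, Real.log_pow, Real.log_pow,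
      Real.log_pow]
    have h4 := mul_le_mul_of_nonneg_right (hδ σ σ₀) hylog.le
    have h5 := mul_le_mul_of_nonneg_right (hδ' σ σ₁) hblog.le
    simp only [e, e']
    push_cast
    linarith
  have hfin : (p : ℝ) ^ (K ^ 2 * ∑ l ∈ range L, l) ≤ (K * L).factorial *
      ((∏ k : Fin K, f k) ^ L * Real.exp (δ * Real.log y + δ' * Real.log b)) := by
    have h0 : 0 < (y : ℝ) ^ e σ₀ * (b : ℝ) ^ e' σ₁ := by positivity
    refine le_of_mul_le_mul_right ((hlow'.trans hup).trans_eq ?_) h0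
    rw [hB]; ring
  have hp0 : (0 : ℝ) < p := by exact_mod_cast hp.pos
  have hprod : (∏ k : Fin K, f k) ≠ 0 := (prod_pos fun k _ => hf0 _).ne'
  have := Real.log_le_log (pow_pos hp0 _) hfin
  rw [Real.log_pow, Real.log_mul (by positivity) (by positivity),
    Real.log_mul (pow_ne_zero _ hprod) (Real.exp_ne_zero _), Real.log_exp, Real.log_pow,
    Real.log_prod fun k _ => (hf0 _).ne', ← Finset.sum_range fun k => Real.log (f k)] at this
  have hlogf : ∀ k, Real.log (f k) = k * Real.log ((R : ℝ) / 2) - Real.log k.factorial := by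
    intro k
    simp only [f]
    rw [Real.log_div (by positivity) (by positivity), Real.log_pow]
  simp only [hlogf] at this
  linarith

theorem sum_sub_mean_sq (T : ℕ) :
    ∑ t ∈ range T, ((t : ℝ) - ((T : ℝ) - 1) / 2) ^ 2 = T * ((T : ℝ) ^ 2 - 1) / 12 := by
  have key : ∀ x : ℝ, ∑ t ∈ range T, ((t : ℝ) - x) ^ 2 =
      T * (T - 1) * (2 * T - 1) / 6 - x * (T * (T - 1)) + T * x ^ 2 := by
    intro x
    induction T with
    | zero => simp
    | succ T ih => rw [sum_range_succ, ih]; push_cast; ring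
  rw [key]; ring

theorem sum_mul_perm_le_add {K L : ℕ} (u : Fin K × Fin L → ℝ) {u₀ W ρ : ℝ} (hρ : 0 < ρ)
    (hW : ∑ i, (u i - u₀) ^ 2 ≤ W) (σ τ : Equiv.Perm (Fin K × Fin L)) :
    ∑ i, ((σ i).2 : ℝ) * u i ≤ ∑ i, ((τ i).2 : ℝ) * u i +
      (ρ * (K * (L * ((L : ℝ) ^ 2 - 1) / 12)) + W / ρ) := by
  set l₀ : ℝ := ((L : ℝ) - 1) / 2
  have hA : ∀ σ : Equiv.Perm (Fin K × Fin L), ∑ i, (((σ i).2 : ℝ) - l₀) ^ 2 =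
      K * (L * ((L : ℝ) ^ 2 - 1) / 12) := by
    intro σ
    rw [Equiv.sum_comp σ (fun i => ((i.2 : ℝ) - l₀) ^ 2), Fintype.sum_prod_type,
      ← sum_sub_mean_sq, Finset.sum_range]
    simp [l₀]
  have hB : ∀ σ : Equiv.Perm (Fin K × Fin L), ∑ i, ((σ i).2 : ℝ) * u i =
      ∑ i, (((σ i).2 : ℝ) - l₀) * (u i - u₀) + ∑ i, ((i.2 : ℝ) * u₀ + l₀ * u i - l₀ * u₀) := by
    intro σ
    have h1 : ∑ i, ((i.2 : ℝ) * u₀ + l₀ * u i - l₀ * u₀) =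
        ∑ i, (((σ i).2 : ℝ) * u₀ + l₀ * u i - l₀ * u₀) := by
      simp only [sum_sub_distrib, sum_add_distrib]
      rw [Equiv.sum_comp σ fun i => (i.2 : ℝ) * u₀]
    rw [h1, ← sum_add_distrib]
    exact sum_congr rfl fun i _ => by ring
  have hC : ∀ (ε : ℝ), ε ^ 2 = 1 → ∀ σ : Equiv.Perm (Fin K × Fin L),
      ε * ∑ i, (((σ i).2 : ℝ) - l₀) * (u i - u₀) ≤
      (ρ * (K * (L * ((L : ℝ) ^ 2 - 1) / 12)) + W / ρ) / 2 := by
    intro ε hε σ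
    calc ε * ∑ i, (((σ i).2 : ℝ) - l₀) * (u i - u₀)
        ≤ ∑ i, (ρ * (((σ i).2 : ℝ) - l₀) ^ 2 + (u i - u₀) ^ 2 / ρ) / 2 := by
          rw [mul_sum]
          refine sum_le_sum fun i _ => ?_
          have h1 : 0 ≤ (ρ * (((σ i).2 : ℝ) - l₀) - ε * (u i - u₀)) ^ 2 / ρ := by positivity
          have h2 : (ρ * (((σ i).2 : ℝ) - l₀) - ε * (u i - u₀)) ^ 2 / ρ =
              ρ * (((σ i).2 : ℝ) - l₀) ^ 2 - 2 * (ε * ((((σ i).2 : ℝ) - l₀) * (u i - u₀))) +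
                ε ^ 2 * ((u i - u₀) ^ 2 / ρ) := by
            field_simp; ring
          rw [h2, hε] at h1
          linarith
      _ = (ρ * ∑ i, (((σ i).2 : ℝ) - l₀) ^ 2 + (∑ i, (u i - u₀) ^ 2) / ρ) / 2 := by
          rw [← sum_div, sum_add_distrib, ← mul_sum, ← sum_div]
      _ ≤ _ := by rw [hA]; gcongr
  rw [hB σ, hB τ]
  have h1 := hC 1 (by norm_num) σ
  have h2 := hC (-1) (by norm_num) τ
  linarith

theorem sum_sub_mean_sq_le_of_injective {ι : Type*} [Fintype ι] {S T : ℕ} (c : ι → ℕ × ℕ)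
    (hc : Function.Injective c) (hcS : ∀ x, (c x).1 < S) (hcT : ∀ x, (c x).2 < T) :
    ∑ i, (((c i).2 : ℝ) - ((T : ℝ) - 1) / 2) ^ 2 ≤ S * (T * ((T : ℝ) ^ 2 - 1) / 12) ∧
    ∑ i, (((c i).1 : ℝ) - ((S : ℝ) - 1) / 2) ^ 2 ≤ T * (S * ((S : ℝ) ^ 2 - 1) / 12) := by
  classical
  have hsub : univ.image c ⊆ range S ×ˢ range T := by
    intro x hx
    obtain ⟨i, -, rfl⟩ := mem_image.mp hx
    simp [hcS i, hcT i]
  have key : ∀ g : ℕ × ℕ → ℝ, (∀ x, 0 ≤ g x) →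
      ∑ i, g (c i) ≤ ∑ s ∈ range S, ∑ t ∈ range T, g (s, t) := by
    intro g hg
    rw [← sum_product', ← sum_image (s := univ) (g := c) (f := g) fun _ _ _ _ h => hc h]
    exact sum_le_sum_of_subset_of_nonneg hsub fun x _ _ => hg x
  constructor
  · refine (key (fun x => ((x.2 : ℝ) - ((T : ℝ) - 1) / 2) ^ 2) fun _ => sq_nonneg _).trans_eq ?_
    simp [sum_sub_mean_sq]
  · refine (key (fun x => ((x.1 : ℝ) - ((S : ℝ) - 1) / 2) ^ 2) fun _ => sq_nonneg _).trans_eq ?_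
    rw [sum_comm]
    simp [sum_sub_mean_sq]

open Polynomial in
theorem exists_det_interpolationMatrix_ne_zero {K L S T r b y : ℕ} (hb : 1 < b) (hy : 0 < y)
    (hT : T ≤ r) (hK : (K - 1) * L < T * (S - L + 1)) (hLS : L ≤ S) :
    ∃ c : Fin K × Fin L → ℕ × ℕ, Function.Injective c ∧ (∀ x, (c x).1 < S) ∧
      (∀ x, (c x).2 < T) ∧ (interpolationMatrix K L S r (-b) y c).det ≠ 0 := by
  let A : Matrix (Fin K × Fin L) (Fin S × Fin T) ℚ := fun i x =>
    (((x.2 : ℕ) + r * (S - 1 - (x.1 : ℕ))).choose i.1 : ℚ) *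
      ((y : ℚ) ^ (x.2 : ℕ) * (-b : ℚ) ^ (x.1 : ℕ)) ^ (i.2 : ℕ)
  have hbin : ∀ (w k : ℕ), (C (k.factorial : ℚ)⁻¹ * descPochhammer ℚ k).eval (w : ℚ) =
      (w.choose k : ℚ) := by
    intro w k
    rw [eval_mul, eval_C, descPochhammer_eval_eq_descFactorial,
      Nat.descFactorial_eq_factorial_mul_choose, Nat.cast_mul, inv_mul_cancel_left₀]
    positivity
  obtain ⟨c, hc, hdet⟩ := exists_submatrix_det_ne_zero A (by
    intro v hv
    let P : Fin L → ℚ[X] := fun l =>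
      ∑ k : Fin K, C (v (k, l)) * (C ((k : ℕ).factorial : ℚ)⁻¹ * descPochhammer ℚ k)
    have hP : P = 0 := by
      refine sum_eval_mul_pow_eq_zero (a := (-b : ℚ)) (y := (y : ℚ)) (by positivity)
        (neg_ne_zero.mpr (by positivity)) ?_ hT hK hLS P ?_ ?_
      · intro i j hij
        have h1 := congrArg abs hij
        simp only [abs_pow, abs_neg, Nat.abs_cast] at h1
        exact Nat.pow_right_injective hb (by exact_mod_cast h1)
      · intro l
        refine natDegree_sum_le_of_forall_le _ _ fun k _ => ?_
        refine (natDegree_C_mul_le _ _).trans ((natDegree_C_mul_le _ _).trans ?_)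
        rw [descPochhammer_natDegree]
        have := k.2
        omega
      · intro s hs t ht
        have h1 := congrFun hv (⟨s, hs⟩, ⟨t, ht⟩)
        rw [Pi.zero_apply] at h1
        rw [← h1, Matrix.vecMul, dotProduct, Fintype.sum_prod_type, Finset.sum_comm]
        refine Finset.sum_congr rfl fun l _ => ?_
        simp only [P, eval_finsetSum, Finset.sum_mul, eval_C_mul (a := v _), hbin, A]
        exact Finset.sum_congr rfl fun k _ => by ring
    ext ⟨k, l⟩
    have hzero : ∀ w : ℕ, ∑ k : Fin K, v (k, l) * (w.choose k : ℚ) = 0 := by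
      intro w
      have h1 := congrArg (Polynomial.eval (w : ℚ)) (congrFun hP l)
      simp only [P, eval_finsetSum, eval_C_mul (a := v _), hbin, Pi.zero_apply, eval_zero] at h1
      exact h1
    have hind : ∀ j : ℕ, ∀ hj : j < K, v (⟨j, hj⟩, l) = 0 := by
      intro j
      induction j using Nat.strong_induction_on with
      | _ j ih =>
        intro hj
        have h1 := hzero j
        rw [Finset.sum_eq_single ⟨j, hj⟩] at h1
        · simpa using h1
        · intro k' _ hne
          rcases lt_trichotomy (k' : ℕ) j with h | h | h
          · rw [ih k' h k'.2, zero_mul]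
          · exact absurd (Fin.ext h) hne
          · rw [Nat.choose_eq_zero_of_lt h, Nat.cast_zero, mul_zero]
        · simp
    exact hind k k.2)
  refine ⟨fun i => ((c i).1, (c i).2), ?_, fun x => (c x).1.2, fun x => (c x).2.2, ?_⟩
  · intro i j hij
    simp only [Prod.mk.injEq] at hij
    exact hc (Prod.ext (Fin.ext hij.1) (Fin.ext hij.2))
  · intro h0
    apply hdet
    have h1 := congrArg (Int.castRingHom ℚ) h0
    rw [RingHom.map_det, map_zero] at h1
    rw [← h1]
    congr 1
    ext i j
    simp [A, interpolationMatrix]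
    rfl

theorem interpolation_inequality {K L S T r n p b y : ℕ} (hp : p.Prime)
    (hy : (p : ℤ) ∣ y - 1) (hb : p.Coprime b) (hb1 : 1 < b) (hy1 : 1 < y)
    (hay : (-b : ℤ) * y ^ r = 1 - p ^ n) (hn : K * L ≤ n) (hR : 0 < r * (S - 1) + T - 1)
    (hL : 0 < L) (hTpos : 0 < T)
    (hT : T ≤ r) (hK : (K - 1) * L < T * (S - L + 1)) (hLS : L ≤ S) :
    (K ^ 2 * ∑ l ∈ Finset.range L, l : ℕ) * Real.log p ≤ Real.log (K * L).factorial +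
      L * ∑ k ∈ Finset.range K,
        (k * Real.log ((r * (S - 1) + T - 1 : ℕ) / 2) - Real.log k.factorial) +
      (K * T * ((L : ℝ) ^ 2 - 1) + L * S * ((T : ℝ) ^ 2 - 1)) / 12 * Real.log y +
      (K * S * ((L : ℝ) ^ 2 - 1) + L * T * ((S : ℝ) ^ 2 - 1)) / 12 * Real.log b := by
  obtain ⟨c, hc, hcS, hcT, hdet⟩ :=
    exists_det_interpolationMatrix_ne_zero (K := K) (b := b) (y := y) hb1 (by omega) hT hK hLS
  obtain ⟨h1, h2⟩ := sum_sub_mean_sq_le_of_injective c hc hcS hcT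
  have hL0 : (0 : ℝ) < L := by exact_mod_cast hL
  have hT0 : (0 : ℝ) < T := by exact_mod_cast hTpos
  have hS0 : (0 : ℝ) < S := by exact_mod_cast hL.trans_le hLS
  refine pow_mul_log_le_of_interpolation hp hy hb hb1 hy1 hay hn hR c hcS hcT hdet _ _ ?_ ?_
  · intro σ τ
    refine (sum_mul_perm_le_add _ (div_pos hT0 hL0) h1 σ τ).trans_eq ?_
    congr 1
    field_simp
  · intro σ τ
    refine (sum_mul_perm_le_add _ (div_pos hS0 hL0) h2 σ τ).trans_eq ?_
    congr 1
    field_simp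

end

theorem le_log_factorial (k : ℕ) (hk : 0 < k) :
    k * Real.log k - k + 1 / 2 ≤ Real.log k.factorial := by
  have h := Stirling.le_log_factorial_stirling hk.ne'
  have h1 : 0 ≤ Real.log k := Real.log_natCast_nonneg k
  have h2 : 1 / 2 ≤ Real.log (2 * Real.pi) / 2 := by
    have : 1 ≤ Real.log (2 * Real.pi) := by
      rw [Real.le_log_iff_exp_le (by positivity)]
      linarith [Real.exp_one_lt_d9, Real.pi_gt_three]
    linarith
  linarith

theorem le_sum_log_factorial (K : ℕ) :
    (K : ℝ) * (K - 1) / 2 * (Real.log K - 3 / 2) ≤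
      ∑ k ∈ Finset.range K, Real.log k.factorial := by
  induction K with
  | zero => simp
  | succ K ih =>
    rcases Nat.eq_zero_or_pos K with rfl | hK
    · simp
    rw [Finset.sum_range_succ]
    refine le_trans ?_ (add_le_add ih (le_log_factorial K hK))
    have hK0 : (0 : ℝ) < K := by exact_mod_cast hK
    have h1 : Real.log ((K + 1 : ℕ) : ℝ) ≤ Real.log K + 1 / K := by
      have h2 : ((K + 1 : ℕ) : ℝ) = K * (1 + 1 / K) := by push_cast; field_simp
      rw [h2, Real.log_mul hK0.ne' (by positivity)]
      have := Real.log_le_sub_one_of_pos (show (0 : ℝ) < 1 + 1 / K by positivity)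
      linarith
    calc ((K + 1 : ℕ) : ℝ) * ((K + 1 : ℕ) - 1) / 2 * (Real.log ((K + 1 : ℕ) : ℝ) - 3 / 2)
        ≤ ((K + 1 : ℕ) : ℝ) * ((K + 1 : ℕ) - 1) / 2 * ((Real.log K + 1 / K) - 3 / 2) := by
          refine mul_le_mul_of_nonneg_left (by linarith) ?_
          push_cast
          rw [add_sub_cancel_right]
          positivity
      _ = _ := by push_cast; field_simp; ring

/-- The interpolation inequality for `17 ^ n = 1 + 16 y ^ r`, with `K = 2 κ` and `T = 2 L`. -/
theorem interpolation_inequality_seventeen {κ L r n y : ℕ} (hy : (17 : ℤ) ∣ y - 1) (hy1 : 1 < y)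
    (h : 17 ^ n = 1 + 16 * y ^ r) (hκ : 0 < κ) (hL : 1 < L) (hLr : 2 * L ≤ r)
    (hn : 2 * κ * L ≤ n) (K σ : ℝ) (hK : K = 2 * κ) (hσ : σ = 1 / 2 + (L - 1) / K) :
    ((L : ℝ) - 1) / 2 * Real.log 17 ≤ Real.log (K * L) / K +
      (Real.log (r * σ / 2) + 3 / 2) / 2 +
      Real.log y / K * (2 * (L ^ 2 - 1) + σ * (4 * L ^ 2 - 1)) / 12 +
      (σ * (L ^ 2 - 1) / L + 2 * L * σ ^ 2) / 12 * Real.log 16 := by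
  have hL0 : (1 : ℝ) < L := by exact_mod_cast hL
  have hκ0 : (1 : ℝ) ≤ κ := by exact_mod_cast hκ
  have hr0 : (4 : ℝ) ≤ r := by exact_mod_cast (by omega : 4 ≤ r)
  have hK0 : 2 ≤ K := by rw [hK]; linarith
  have hS : ((κ + L - 1 : ℕ) : ℝ) = σ * K := by
    rw [hσ, Nat.cast_sub (by omega)]
    push_cast
    field_simp
    rw [hK]; ring
  have hσ0 : 1 / 2 < σ := by
    rw [hσ]
    have : 0 < ((L : ℝ) - 1) / K := div_pos (by linarith) (by linarith)
    linarith
  have main := interpolation_inequality (K := 2 * κ) (L := L) (S := κ + L - 1) (T := 2 * L)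
    (r := r) (n := n) (p := 17) (b := 16) (y := y) (by norm_num) hy (by norm_num) (by norm_num) hy1
    (by
      have : (17 : ℤ) ^ n = 1 + 16 * y ^ r := by exact_mod_cast h
      push_cast; linarith) hn (by have : 0 ≤ r * (κ + L - 1 - 1) := Nat.zero_le _; omega)
    (by omega) (by omega) hLr
    (by
      rw [show κ + L - 1 - L + 1 = κ by omega, show 2 * L * κ = 2 * κ * L by ring]
      exact Nat.mul_lt_mul_of_pos_right (by omega) (by omega)) (by omega)
  have hV : ((((2 * κ) ^ 2 * ∑ l ∈ Finset.range L, l : ℕ)) : ℝ) = K ^ 2 * (L * (L - 1) / 2) := by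
    have h1 := Finset.sum_range_id_mul_two L
    have h2 : ((∑ l ∈ Finset.range L, l : ℕ) : ℝ) * 2 = L * (L - 1) := by
      have : ((L - 1 : ℕ) : ℝ) = L - 1 := by rw [Nat.cast_sub (by omega), Nat.cast_one]
      rw [← this]; exact_mod_cast h1
    rw [Nat.cast_mul, hK]; push_cast at h2 ⊢; linear_combination 2 * κ ^ 2 * h2
  have hfac : Real.log ((2 * κ * L).factorial : ℝ) ≤ K * L * Real.log (K * L) := by
    have h1 : ((2 * κ * L).factorial : ℝ) ≤ (K * L) ^ (2 * κ * L) := by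
      rw [hK]; exact_mod_cast Nat.factorial_le_pow (2 * κ * L)
    refine (Real.log_le_log (by positivity) h1).trans_eq ?_
    rw [Real.log_pow, hK]; push_cast; ring
  have hR : Real.log (((r * (κ + L - 1 - 1) + 2 * L - 1 : ℕ) : ℝ) / 2) ≤
      Real.log (r * σ / 2) + Real.log K := by
    rw [← Real.log_mul (by positivity) (by positivity)]
    refine Real.log_le_log ?_ ?_
    · have : (0 : ℝ) < ((r * (κ + L - 1 - 1) + 2 * L - 1 : ℕ) : ℝ) := by
        exact_mod_cast (by omega : 0 < r * (κ + L - 1 - 1) + 2 * L - 1)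
      positivity
    · have h1 : r * (κ + L - 1 - 1) + 2 * L - 1 ≤ r * (κ + L - 1) := by
        have : κ + L - 1 = (κ + L - 1 - 1) + 1 := by omega
        rw [this, mul_add]
        simp only [Nat.add_sub_cancel]
        omega
      have h2 : ((r * (κ + L - 1 - 1) + 2 * L - 1 : ℕ) : ℝ) ≤ r * (σ * K) := by
        rw [← hS]; exact_mod_cast h1
      linarith
  have hA : 0 ≤ Real.log (r * σ / 2) := Real.log_nonneg (by nlinarith)
  have hsum : ∑ k ∈ Finset.range (2 * κ), ((k : ℝ) * Real.log
      (((r * (κ + L - 1 - 1) + 2 * L - 1 : ℕ) : ℝ) / 2) - Real.log k.factorial) ≤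
      K * K / 2 * (Real.log (r * σ / 2) + 3 / 2) := by
    have h1 := le_sum_log_factorial (2 * κ)
    have h2 : ((2 * κ : ℕ) : ℝ) = K := by rw [hK]; push_cast; ring
    have h3 : (∑ k ∈ Finset.range (2 * κ), (k : ℝ)) = K * (K - 1) / 2 := by
      have h4 := Finset.sum_range_id_mul_two (2 * κ)
      have h5 : ((2 * κ - 1 : ℕ) : ℝ) = K - 1 := by
        rw [Nat.cast_sub (by omega), h2, Nat.cast_one]
      have h6 : (∑ k ∈ Finset.range (2 * κ), (k : ℝ)) * 2 = K * (K - 1) := by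
        rw [← h5, ← h2, ← Nat.cast_sum]; exact_mod_cast h4
      linarith
    rw [h2] at h1
    rw [Finset.sum_sub_distrib, ← Finset.sum_mul, h3]
    have h7 : 0 ≤ K * (K - 1) / 2 := by nlinarith
    have h8 := mul_le_mul_of_nonneg_left hR h7
    have h9 : 0 ≤ K / 2 * (Real.log (r * σ / 2) + 3 / 2) := by positivity
    nlinarith
  rw [hV, hS] at main
  push_cast at main
  rw [← hK] at main
  have hLpos : (0 : ℝ) < L := by linarith
  have hmain2 := main.trans (add_le_add (add_le_add (add_le_add hfac
    (mul_le_mul_of_nonneg_left (by exact_mod_cast hsum) hLpos.le)) le_rfl) le_rfl)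
  have hKL : 0 < K * L := by positivity
  have h16 : 0 ≤ Real.log 16 := Real.log_nonneg (by norm_num)
  refine le_of_mul_le_mul_left ?_ (mul_pos hKL (show (0 : ℝ) < K by linarith))
  have hexp : K * L * K * (Real.log (K * L) / K + (Real.log (r * σ / 2) + 3 / 2) / 2 +
      Real.log y / K * (2 * (L ^ 2 - 1) + σ * (4 * L ^ 2 - 1)) / 12 +
      (σ * (L ^ 2 - 1) / L + 2 * L * σ ^ 2) / 12 * Real.log 16) =
      K * L * Real.log (K * L) + L * (K * K / 2 * (Real.log (r * σ / 2) + 3 / 2)) +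
      (K * (2 * L) * (L ^ 2 - 1) + L * (σ * K) * ((2 * L) ^ 2 - 1)) / 12 * Real.log y +
      (K * (σ * K) * (L ^ 2 - 1) + L * (2 * L) * ((σ * K) ^ 2 - 1)) / 12 * Real.log 16 +
      L * (2 * L) / 12 * Real.log 16 := by
    field_simp
    ring
  have hpos : 0 ≤ (L : ℝ) * (2 * L) / 12 * Real.log 16 := by positivity
  rw [hexp]
  linarith

set_option maxHeartbeats 1000000 in
theorem interpolation_bound {L r n y : ℕ} (hy : (17 : ℤ) ∣ y - 1) (hy1 : 1 < y)
    (h : 17 ^ n = 1 + 16 * y ^ r) (hL : 1 < L) (hLr : 2 * L ≤ r) (K σ rl rh : ℝ) (hK : 3 ≤ K)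
    (hσ : σ = 1 / 2 + (L - 1) / K) (hrl : 0 < rl) (hrl' : rl ≤ r) (hrh : (r : ℝ) ≤ rh)
    (hKy : (K / 2 + 1) * (2 * L * Real.log 17) ≤ r * Real.log y) :
    ((L : ℝ) - 1) / 2 * Real.log 17 ≤ Real.log (K * L) / K +
      (Real.log (rh * σ / 2) + 3 / 2) / 2 +
      (1 + 2 / K) * (L / rl) * Real.log 17 * (2 * (L ^ 2 - 1) + σ * (4 * L ^ 2 - 1)) / 12 +
      (σ * (L ^ 2 - 1) / L + 2 * L * σ ^ 2) / 12 * Real.log 16 := by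
  have hL0 : (1 : ℝ) < L := by exact_mod_cast hL
  have hl17 : 0 < Real.log 17 := Real.log_pos (by norm_num)
  have hl16 : 0 < Real.log 16 := Real.log_pos (by norm_num)
  have hly : 0 < Real.log y := Real.log_pos (by exact_mod_cast hy1)
  set D : ℝ := 2 * L * Real.log 17 with hD
  have hD0 : 0 < D := by positivity
  set κ : ℕ := ⌊r * Real.log y / D⌋₊ with hκ
  have h1 : (κ : ℝ) ≤ r * Real.log y / D := Nat.floor_le (by positivity)
  have h2 : r * Real.log y / D < κ + 1 := Nat.lt_floor_add_one _
  have h3 : K / 2 + 1 ≤ r * Real.log y / D := by rwa [le_div_iff₀ hD0]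
  have hκK : K ≤ 2 * κ := by linarith
  have hκ0 : (0 : ℝ) < κ := by linarith
  rw [le_div_iff₀ hD0] at h1
  rw [div_lt_iff₀ hD0] at h2
  have hn : 2 * κ * L ≤ n := by
    have h4 : r * Real.log y ≤ n * Real.log 17 := by
      rw [← Real.log_pow, ← Real.log_pow]
      refine Real.log_le_log (by positivity) ?_
      have : y ^ r ≤ 17 ^ n := by omega
      exact_mod_cast this
    have h5 : (2 * κ * L : ℝ) * Real.log 17 ≤ n * Real.log 17 := by
      rw [hD] at h1; linarith
    exact_mod_cast le_of_mul_le_mul_right h5 hl17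
  have main := interpolation_inequality_seventeen hy hy1 h (by exact_mod_cast hκ0) hL hLr hn
    (2 * κ) (1 / 2 + (L - 1) / (2 * κ)) rfl rfl
  refine main.trans ?_
  have hσ1 : 1 / 2 + ((L : ℝ) - 1) / (2 * κ) ≤ σ := by
    rw [hσ]; gcongr
  have hσ0 : 0 < 1 / 2 + ((L : ℝ) - 1) / (2 * κ) := by
    have : 0 < ((L : ℝ) - 1) / (2 * κ) := div_pos (by linarith) (by linarith)
    linarith
  have hr0 : (0 : ℝ) < r := by linarith
  have hLsq : 1 < (L : ℝ) ^ 2 := by nlinarith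
  have t1 : Real.log (2 * κ * L) / (2 * κ) ≤ Real.log (K * L) / K := by
    have h6 := Real.log_div_self_antitoneOn (a := K * L) (b := 2 * κ * L)
      (by
        have := Real.exp_one_lt_d9
        rw [Set.mem_Ici]; nlinarith)
      (by
        have := Real.exp_one_lt_d9
        rw [Set.mem_Ici]; nlinarith) (by gcongr)
    simp only at h6
    have h7 := mul_le_mul_of_nonneg_right h6 (by linarith : (0 : ℝ) ≤ L)
    have e1 : Real.log (2 * κ * L) / (2 * κ * L) * L = Real.log (2 * κ * L) / (2 * κ) := by
      field_simp
    have e2 : Real.log (K * L) / (K * L) * L = Real.log (K * L) / K := by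
      field_simp
    rwa [e1, e2] at h7
  have t2 : Real.log (r * (1 / 2 + (L - 1) / (2 * κ)) / 2) ≤ Real.log (rh * σ / 2) :=
    Real.log_le_log (by positivity) (by gcongr; linarith)
  have t3 : Real.log y / (2 * κ) ≤ (1 + 2 / K) * (L / rl) * Real.log 17 := by
    have h8 : Real.log y ≤ (κ + 1) * D / r := by rw [le_div_iff₀ hr0]; linarith
    calc Real.log y / (2 * κ) ≤ ((κ + 1) * D / r) / (2 * κ) := by gcongr
      _ = (1 + 2 / (2 * κ)) * (L / r) * Real.log 17 := by rw [hD]; field_simp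
      _ ≤ _ := by gcongr
  have h9 : 0 ≤ (L : ℝ) ^ 2 - 1 := by linarith
  have h10 : 0 ≤ 4 * (L : ℝ) ^ 2 - 1 := by linarith
  gcongr

theorem log_le_div_mul_log_two {x : ℝ} (a b : ℕ) (hb : 0 < b) (hx : 0 < x)
    (h : x ^ b ≤ 2 ^ a) : Real.log x ≤ a / b * Real.log 2 := by
  have h1 := Real.log_le_log (by positivity) h
  rw [Real.log_pow, Real.log_pow] at h1
  have hb' : (0 : ℝ) < b := by exact_mod_cast hb
  rw [div_mul_eq_mul_div, le_div_iff₀ hb']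
  linarith

theorem log_seventeen_le : Real.log 17 ≤ 2.8334 := by
  have h := log_le_div_mul_log_two (x := 17) 233 57 (by norm_num) (by norm_num) (by norm_num)
  have := Real.log_two_lt_d9
  norm_num at h ⊢
  linarith

theorem le_log_seventeen : 2.8328 ≤ Real.log 17 := by
  have h1 := Real.log_le_log (x := 2 ^ 94) (y := 17 ^ 23) (by norm_num) (by norm_num)
  rw [Real.log_pow, Real.log_pow] at h1
  have := Real.log_two_gt_d9
  norm_num at h1 ⊢
  linarith

theorem log_sixteen_eq : Real.log 16 = 4 * Real.log 2 := by
  rw [show (16 : ℝ) = 2 ^ 4 by norm_num, Real.log_pow]; norm_num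

theorem log_le_tangent {x c : ℝ} (hx : 0 < x) (hc : 0 < c) :
    Real.log x ≤ Real.log c + x / c - 1 := by
  have h := Real.log_le_sub_one_of_pos (div_pos hx hc)
  rw [Real.log_div hx.ne' hc.ne'] at h
  linarith

/-- The exponent `n` in `17 ^ n = 1 + 16 * y ^ r` controls `log y` from below. -/
theorem sub_one_mul_log_le {r n y : ℕ} (hy1 : 1 < y) (h : 17 ^ n = 1 + 16 * y ^ r) :
    ((n : ℝ) - 1) * Real.log 17 ≤ r * Real.log y := by
  have h1 : (17 : ℝ) ^ n ≤ 17 * (y : ℝ) ^ r := by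
    have : 1 ≤ y ^ r := Nat.one_le_pow _ _ (by omega)
    have : 17 ^ n ≤ 17 * y ^ r := by omega
    exact_mod_cast this
  have hy0 : (0 : ℝ) < y := by exact_mod_cast (by omega : 0 < y)
  have h2 := Real.log_le_log (by positivity) h1
  rw [Real.log_pow, Real.log_mul (by norm_num) (by positivity), Real.log_pow] at h2
  linarith

theorem exponent_lt_of_forty_seven {n y : ℕ} (hy : (17 : ℤ) ∣ y - 1) (hy1 : 1 < y)
    (h : 17 ^ n = 1 + 16 * y ^ 47) : n < 1609 := by
  by_contra! hn
  have hl := sub_one_mul_log_le hy1 h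
  have hn' : (1609 : ℝ) ≤ n := by exact_mod_cast hn
  have l1 := log_seventeen_le
  have l2 := le_log_seventeen
  have b := interpolation_bound (L := 4) hy hy1 h (by norm_num) (by norm_num) 400 (203 / 400) 47 47
    (by norm_num) (by norm_num) (by norm_num) (by norm_num) (by norm_num)
    (by refine le_trans ?_ hl; push_cast; nlinarith)
  rw [log_sixteen_eq] at b
  have b1 := log_le_div_mul_log_two (x := 400 * 4) 11 1 (by norm_num) (by norm_num) (by norm_num)
  have b2 := log_le_div_mul_log_two (x := 47 * (203 / 400) / 2) 18 5 (by norm_num) (by norm_num)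
    (by norm_num)
  have := Real.log_two_lt_d9
  norm_num at b b1 b2 l1 l2 this
  linarith

theorem exponent_lt_of_le_seventy_three {r n y : ℕ} (hy : (17 : ℤ) ∣ y - 1) (hy1 : 1 < y)
    (h : 17 ^ n = 1 + 16 * y ^ r) (hr1 : 53 ≤ r) (hr2 : r ≤ 73) : n < 2011 := by
  by_contra! hn
  have hl := sub_one_mul_log_le hy1 h
  have hn' : (2011 : ℝ) ≤ n := by exact_mod_cast hn
  have l1 := log_seventeen_le
  have l2 := le_log_seventeen
  have b := interpolation_bound (L := 5) hy hy1 h (by norm_num) (by omega) 400 (51 / 100) 53 73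
    (by norm_num) (by norm_num) (by norm_num) (by exact_mod_cast hr1) (by exact_mod_cast hr2)
    (by refine le_trans ?_ hl; push_cast; nlinarith)
  rw [log_sixteen_eq] at b
  have b1 := log_le_div_mul_log_two (x := 400 * 5) 11 1 (by norm_num) (by norm_num) (by norm_num)
  have b2 := log_le_div_mul_log_two (x := 73 * (51 / 100) / 2) 38 9 (by norm_num) (by norm_num)
    (by norm_num)
  have := Real.log_two_lt_d9
  norm_num at b b1 b2 l1 l2 this
  linarith

theorem log_le_of_linear_bound {r n y : ℕ} (hyn : 34 * n + 1 ≤ y) (hnr : r < n)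
    (h : 17 ^ n = 1 + 16 * y ^ r) (hr : 79 ≤ r) : 3.19 * Real.log 17 ≤ Real.log y := by
  have step : ∀ a b, 17 ^ a ≤ y ^ b → a * r < b * n + 1 := by
    intro a b hab
    have h1 : 17 ^ (a * r) ≤ 17 ^ (b * n) := by
      calc 17 ^ (a * r) = (17 ^ a) ^ r := pow_mul _ _ _
        _ ≤ (y ^ b) ^ r := Nat.pow_le_pow_left hab _
        _ = (y ^ r) ^ b := by rw [← pow_mul, ← pow_mul, mul_comm]
        _ ≤ (17 ^ n) ^ b := Nat.pow_le_pow_left (by omega) _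
        _ = 17 ^ (b * n) := by rw [← pow_mul, mul_comm]
    have := (Nat.pow_le_pow_iff_right (by norm_num : 1 < 17)).1 h1
    omega
  have e1 := step 39 14 (le_trans (by norm_num) (Nat.pow_le_pow_left (by omega : 2721 ≤ y) 14))
  have e2 := step 63 20 (le_trans (by norm_num) (Nat.pow_le_pow_left (by omega : 7515 ≤ y) 20))
  have e3 : 17 ^ 67 ≤ y ^ 21 :=
    le_trans (by norm_num) (Nat.pow_le_pow_left (by omega : 8467 ≤ y) 21)
  have e4 : (17 : ℝ) ^ 67 ≤ (y : ℝ) ^ 21 := by exact_mod_cast e3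
  have e5 := Real.log_le_log (by norm_num) e4
  rw [Real.log_pow, Real.log_pow] at e5
  have := le_log_seventeen
  norm_num at e5 this ⊢
  linarith

theorem lt_one_hundred_eight {r n y : ℕ} (hy : (17 : ℤ) ∣ y - 1) (hy1 : 1 < y)
    (h : 17 ^ n = 1 + 16 * y ^ r) (hl : 3.19 * r * Real.log 17 ≤ r * Real.log y) : r < 108 := by
  by_contra! h108
  have l1 := log_seventeen_le
  have l2 := le_log_seventeen
  have l3 := Real.log_two_lt_d9
  obtain ⟨L, hL⟩ : ∃ L, L = Nat.sqrt (r / 3) := ⟨_, rfl⟩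
  have q1 : L * L ≤ r / 3 := hL ▸ Nat.sqrt_le _
  have q2 : r / 3 < (L + 1) * (L + 1) := hL ▸ Nat.sqrt_lt.1 (Nat.lt_succ_self _)
  have hL6 : 6 ≤ L := by rw [hL, Nat.le_sqrt]; omega
  have q3 : 3 * (L * L) ≤ r := by omega
  have q4 : r ≤ 3 * ((L + 1) * (L + 1)) := by omega
  have hL6' : (6 : ℝ) ≤ L := by exact_mod_cast hL6
  have q3' : 3 * (L : ℝ) ^ 2 ≤ r := by rw [pow_two]; exact_mod_cast q3
  have q4' : (r : ℝ) ≤ 3 * (L + 1) ^ 2 := by rw [pow_two]; exact_mod_cast q4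
  have b := interpolation_bound (L := L) hy hy1 h (by omega) (by nlinarith) (9 * L)
    (1 / 2 + (L - 1) / (9 * L)) (3 * L ^ 2) (3 * (L + 1) ^ 2) (by linarith) rfl (by positivity)
    q3' q4' (by
      refine le_trans ?_ hl
      have : ((9 * (L : ℝ)) / 2 + 1) * (2 * L) ≤ 3.19 * r := by norm_num; nlinarith
      nlinarith)
  have hLp : (0 : ℝ) < L := by linarith
  set σ : ℝ := 1 / 2 + (L - 1) / (9 * L) with hσ
  have hσ1 : σ ≤ 11 / 18 := by
    have : ((L : ℝ) - 1) / (9 * L) ≤ 1 / 9 := by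
      rw [div_le_iff₀ (by positivity)]; linarith
    linarith
  have hσ0 : 0 < σ := by
    have : 0 < ((L : ℝ) - 1) / (9 * L) := div_pos (by linarith) (by positivity)
    linarith
  have t1 : Real.log (9 * L * L) / (9 * L) ≤ 0.108 := by
    have h1 : Real.log (9 * (L : ℝ) * L) = 2 * Real.log (3 * L) := by
      rw [show 9 * (L : ℝ) * L = (3 * L) ^ 2 by ring, Real.log_pow]; norm_num
    have h2 := log_le_tangent (x := 3 * (L : ℝ)) (c := 18) (by positivity) (by norm_num)
    have h3 := log_le_div_mul_log_two (x := 18) 21 5 (by norm_num) (by norm_num) (by norm_num)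
    rw [div_le_iff₀ (by positivity), h1]
    norm_num at h3 l3 ⊢
    linarith
  have t2 : (Real.log (3 * (L + 1) ^ 2 * σ / 2) + 3 / 2) / 2 ≤ L / 7 + 1.86 := by
    have h1 : Real.log (3 * (L + 1) ^ 2 * σ / 2) ≤ Real.log ((L + 1) ^ 2) :=
      Real.log_le_log (by positivity) (by nlinarith [sq_nonneg ((L : ℝ) + 1)])
    rw [Real.log_pow] at h1
    have h2 := log_le_tangent (x := (L : ℝ) + 1) (c := 7) (by positivity) (by norm_num)
    have h3 := log_le_div_mul_log_two (x := 7) 17 6 (by norm_num) (by norm_num) (by norm_num)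
    norm_num at h1 h3 l3 ⊢
    linarith
  have t3 : (1 + 2 / (9 * L)) * (L / (3 * L ^ 2)) * Real.log 17 *
      (2 * (L ^ 2 - 1) + σ * (4 * L ^ 2 - 1)) / 12 ≤ (L + 2 / 9) * (10 / 81) * Real.log 17 := by
    have h1 : 2 * ((L : ℝ) ^ 2 - 1) + σ * (4 * L ^ 2 - 1) ≤ 40 / 9 * L ^ 2 := by
      nlinarith [sq_nonneg (L : ℝ)]
    calc _ ≤ (1 + 2 / (9 * (L : ℝ))) * (L / (3 * L ^ 2)) * Real.log 17 * (40 / 9 * L ^ 2) / 12 := by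
          gcongr
      _ = _ := by field_simp; norm_num
  have t4 : (σ * ((L : ℝ) ^ 2 - 1) / L + 2 * L * σ ^ 2) / 12 * Real.log 16 ≤
      (L * (11 / 18) + 2 * L * (11 / 18) ^ 2) / 12 * Real.log 16 := by
    have h1 : σ * ((L : ℝ) ^ 2 - 1) / L ≤ L * (11 / 18) := by
      rw [div_le_iff₀ hLp]; nlinarith
    gcongr
  rw [log_sixteen_eq] at b t4
  have key := b.trans (add_le_add (add_le_add (add_le_add t1 t2) t3) t4)
  norm_num at key l1 l2 l3
  have p1 := mul_nonneg (sub_nonneg.2 l2) (sub_nonneg.2 hL6')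
  have p2 := mul_nonneg (sub_nonneg.2 l3.le) hLp.le
  linarith

theorem lt_seventy_nine {r n y : ℕ} (hy : (17 : ℤ) ∣ y - 1) (hyn : 34 * n + 1 ≤ y) (hnr : r < n)
    (h : 17 ^ n = 1 + 16 * y ^ r) : r < 79 := by
  by_contra! hr
  have hy1 : 1 < y := by omega
  have hl := log_le_of_linear_bound hyn hnr h hr
  have l1 := log_seventeen_le
  have l2 := le_log_seventeen
  have l3 := Real.log_two_lt_d9
  have hr0 : (79 : ℝ) ≤ r := by exact_mod_cast hr
  have hl' : 3.19 * r * Real.log 17 ≤ r * Real.log y := by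
    have := mul_le_mul_of_nonneg_left hl (by linarith : (0 : ℝ) ≤ r)
    linarith
  rcases lt_or_ge r 89 with h89 | h89
  · have b := interpolation_bound (L := 5) hy hy1 h (by norm_num) (by omega) 48 (7 / 12) 79 88
      (by norm_num) (by norm_num) (by norm_num) (by exact_mod_cast hr)
      (by exact_mod_cast (by omega : r ≤ 88))
      (by refine le_trans ?_ hl'; push_cast; nlinarith)
    rw [log_sixteen_eq] at b
    have b1 := log_le_div_mul_log_two (x := 48 * 5) 8 1 (by norm_num) (by norm_num) (by norm_num)
    have b2 := log_le_div_mul_log_two (x := 88 * (7 / 12) / 2) 33 7 (by norm_num) (by norm_num)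
      (by norm_num)
    norm_num at b b1 b2 l1 l2 l3
    linarith
  · have h108 := lt_one_hundred_eight hy hy1 h hl'
    have hr0 : (89 : ℝ) ≤ r := by exact_mod_cast h89
    have b := interpolation_bound (L := 5) hy hy1 h (by norm_num) (by omega) 50 (29 / 50) 89 108
      (by norm_num) (by norm_num) (by norm_num) (by exact_mod_cast h89)
      (by exact_mod_cast (by omega : r ≤ 108))
      (by refine le_trans ?_ hl'; push_cast; nlinarith)
    rw [log_sixteen_eq] at b
    have b1 := log_le_div_mul_log_two (x := 50 * 5) 8 1 (by norm_num) (by norm_num) (by norm_num)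
    have b2 := log_le_div_mul_log_two (x := 108 * (29 / 50) / 2) 5 1 (by norm_num) (by norm_num)
      (by norm_num)
    norm_num at b b1 b2 l1 l2 l3
    linarith

/-- Powers of `1 + 4 * i` and `1 - 4 * i` with a positive even exponent, to 2-adic precision. -/
theorem exists_pow_two_pow_eq {e : ℤ} (he : e = 4 ∨ e = -4) (s : ℕ) :
    ∃ a b : ℤ, (⟨1, e⟩ : GaussianInt) ^ 2 ^ (s + 1) =
      ⟨1 + 2 ^ (s + 4) * (2 * b + 1), 2 ^ (s + 3) * a⟩ := by
  induction s with
  | zero =>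
    rcases he with rfl | rfl
    · exact ⟨1, -1, by norm_num [pow_two, Zsqrtd.ext_iff]⟩
    · exact ⟨-1, -1, by norm_num [pow_two, Zsqrtd.ext_iff]⟩
  | succ s ih =>
    obtain ⟨a, b, h⟩ := ih
    refine ⟨a * (1 + 2 ^ (s + 4) * (2 * b + 1)),
      b + 2 ^ (s + 2) * (2 * b + 1) ^ 2 - 2 ^ s * a ^ 2, ?_⟩
    rw [pow_succ 2 (s + 1), pow_mul, h, pow_two, Zsqrtd.ext_iff]
    constructor
    · simp only [Zsqrtd.re_mul]
      ring
    · simp only [Zsqrtd.im_mul]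
      ring

theorem exists_pow_eq_of_even_part (s v : ℕ) (g : GaussianInt) (a b : ℤ)
    (hg : g = ⟨1 + 2 ^ (s + 4) * b, 2 ^ (s + 3) * a⟩) :
    ∃ a' b' : ℤ, g ^ v = ⟨1 + 2 ^ (s + 4) * b', 2 ^ (s + 3) * a'⟩ := by
  induction v with
  | zero => exact ⟨0, 0, by simp [Zsqrtd.ext_iff]⟩
  | succ v ih =>
    obtain ⟨a', b', h⟩ := ih
    refine ⟨a' * (1 + 2 ^ (s + 4) * b) + a * (1 + 2 ^ (s + 4) * b'),
      b + b' + 2 ^ (s + 4) * b * b' - 2 ^ (s + 2) * a * a', ?_⟩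
    rw [pow_succ, h, hg, Zsqrtd.ext_iff]
    constructor
    · simp only [Zsqrtd.re_mul]
      ring
    · simp only [Zsqrtd.im_mul]
      ring

theorem re_pow_ne_one {e : ℤ} (he : e = 4 ∨ e = -4) {n : ℕ} (hn : Odd n) (h1 : 1 < n) :
    ((⟨1, e⟩ : GaussianInt) ^ n).re ≠ 1 := by
  obtain ⟨k, rfl⟩ := hn
  obtain ⟨s, u, hu, hk⟩ := Nat.exists_eq_two_pow_mul_odd (n := k) (by omega)
  obtain ⟨v, rfl⟩ := hu
  obtain ⟨a, b, h⟩ := exists_pow_two_pow_eq he s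
  obtain ⟨a2, b2, h2⟩ := exists_pow_two_pow_eq he (s + 1)
  obtain ⟨a', b', h'⟩ := exists_pow_eq_of_even_part (s + 1) v _ _ _ h2
  have hexp : 2 * k + 1 = 2 ^ (s + 1) + 2 ^ (s + 1 + 1) * v + 1 := by rw [hk]; ring
  rw [hexp, pow_succ, pow_add, pow_mul, h, h']
  intro hre
  simp only [Zsqrtd.re_mul, Zsqrtd.im_mul] at hre
  obtain ⟨c, hc⟩ : ∃ c : ℤ, e = 4 * c := by
    rcases he with rfl | rfl
    · exact ⟨1, rfl⟩
    · exact ⟨-1, rfl⟩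
  rw [hc] at hre
  have h2s : (2 : ℤ) ^ (s + 4) ≠ 0 := by positivity
  have : (2 : ℤ) ^ (s + 4) * (2 * b + 1 + 2 * b' + 2 ^ (s + 5) * (2 * b + 1) * b'
      - 2 ^ (s + 3) * a * a' + -1 * (a * (1 + 2 ^ (s + 5) * b') * 2 * c
      + (1 + 2 ^ (s + 4) * (2 * b + 1)) * 4 * a' * c)) = 0 := by
    have e1 : (2 : ℤ) ^ (s + 1 + 4) = 2 ^ s * 32 := by rw [pow_add, pow_add]; norm_num; ring
    have e2 : (2 : ℤ) ^ (s + 1 + 3) = 2 ^ s * 16 := by rw [pow_add, pow_add]; norm_num; ring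
    have e3 : (2 : ℤ) ^ (s + 4) = 2 ^ s * 16 := by rw [pow_add]; norm_num
    have e4 : (2 : ℤ) ^ (s + 3) = 2 ^ s * 8 := by rw [pow_add]; norm_num
    have e5 : (2 : ℤ) ^ (s + 5) = 2 ^ s * 32 := by rw [pow_add]; norm_num
    rw [e1, e2, e4] at hre
    rw [e3, e4, e5]
    linear_combination hre
  have h3 := (mul_eq_zero.1 this).resolve_left h2s
  rw [show s + 5 = (s + 4) + 1 by ring, show s + 3 = (s + 2) + 1 by ring, pow_succ, pow_succ] at h3
  have : (2 : ℤ) ∣ 1 := ⟨-(b + b' + 2 ^ (s + 4) * (2 * b + 1) * b' - 2 ^ (s + 2) * a * a' + -1 *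
      (a * (1 + 2 ^ (s + 4) * 2 * b') * c + (1 + 2 ^ (s + 4) * (2 * b + 1)) * 2 * a' * c)), by
      linear_combination h3⟩
  omega

theorem re_pow_emod_four {e : ℤ} (he : (4 : ℤ) ∣ e) (n : ℕ) :
    ((⟨1, e⟩ : GaussianInt) ^ n).re % 4 = 1 ∧ (4 : ℤ) ∣ ((⟨1, e⟩ : GaussianInt) ^ n).im := by
  obtain ⟨c, rfl⟩ := he
  induction n with
  | zero => simp
  | succ n ih =>
    obtain ⟨h1, d, h2⟩ := ih
    rw [pow_succ, Zsqrtd.re_mul, Zsqrtd.im_mul, h2]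
    refine ⟨?_, ⟨((⟨1, 4 * c⟩ : GaussianInt) ^ n).re * c + d, by ring⟩⟩
    have : ((⟨1, 4 * c⟩ : GaussianInt) ^ n).re * 1 + -1 * (4 * d) * (4 * c) =
      ((⟨1, 4 * c⟩ : GaussianInt) ^ n).re + 4 * (-4 * d * c) := by ring
    rw [this]; omega

theorem GaussianInt.pow_four_eq_one {u : GaussianInt} (hu : IsUnit u) : u ^ 4 = 1 := by
  have h := (Zsqrtd.norm_eq_one_iff' (by norm_num) u).2 hu
  obtain ⟨x, y⟩ := u
  simp only [Zsqrtd.norm_def] at h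
  have hx : x ^ 2 ≤ 1 := by nlinarith [sq_nonneg y]
  have hy : y ^ 2 ≤ 1 := by nlinarith [sq_nonneg x]
  have : x ≤ 1 := by nlinarith
  have : -1 ≤ x := by nlinarith
  have : y ≤ 1 := by nlinarith
  have : -1 ≤ y := by nlinarith
  interval_cases x <;> interval_cases y <;> first | omega | decide

theorem seventeen_pow_ne_one_add_sixteen_mul_sq {n : ℕ} (hn : Odd n) (h1 : 1 < n) (z : ℤ) :
    17 ^ n ≠ 1 + 16 * z ^ 2 := by
  intro h
  have hAB : (⟨1, 4 * z⟩ : GaussianInt) * ⟨1, -(4 * z)⟩ = ((17 : ℤ) : GaussianInt) ^ n := by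
    rw [← Int.cast_pow, h, Zsqrtd.ext_iff]
    simp only [Zsqrtd.re_mul, Zsqrtd.im_mul, Zsqrtd.re_intCast, Zsqrtd.im_intCast]
    constructor <;> ring
  have hcop : IsCoprime (⟨1, 4 * z⟩ : GaussianInt) ⟨1, -(4 * z)⟩ := by
    refine ⟨⟨1, -(4 * z)⟩ - ((8 * z ^ 2 : ℤ) : GaussianInt), -((8 * z ^ 2 : ℤ) : GaussianInt), ?_⟩
    rw [Zsqrtd.ext_iff]
    simp only [Zsqrtd.re_add, Zsqrtd.im_add, Zsqrtd.re_sub, Zsqrtd.im_sub, Zsqrtd.re_neg,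
      Zsqrtd.im_neg, Zsqrtd.re_mul, Zsqrtd.im_mul, Zsqrtd.re_intCast, Zsqrtd.im_intCast,
      Zsqrtd.re_one, Zsqrtd.im_one]
    constructor <;> ring
  obtain ⟨d, u, hu⟩ := exists_associated_pow_of_mul_eq_pow' hcop hAB
  have hu4 : (u : GaussianInt) ^ 4 = 1 := GaussianInt.pow_four_eq_one u.isUnit
  have hun : (u : GaussianInt) = (u ^ n) ^ n := by
    rw [← pow_mul]
    obtain ⟨k, rfl⟩ := hn
    rw [show (2 * k + 1) * (2 * k + 1) = 4 * (k * k + k) + 1 by ring, pow_succ, pow_mul, hu4]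
    simp
  rw [hun, ← mul_pow] at hu
  obtain ⟨⟨c, e⟩, hg⟩ : ∃ g, d * (u : GaussianInt) ^ n = g := ⟨_, rfl⟩
  rw [hg] at hu
  have hnorm : c * c + e * e = 17 := by
    have h2 := congrArg Zsqrtd.norm hu
    have h3 : Zsqrtd.norm ((⟨c, e⟩ : GaussianInt) ^ n) = (Zsqrtd.norm (⟨c, e⟩ : GaussianInt)) ^ n :=
      map_pow Zsqrtd.normMonoidHom _ _
    rw [h3] at h2
    simp only [Zsqrtd.norm_def] at h2
    have h4 : (c * c + e * e) ^ n = 17 ^ n := by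
      rw [h]; linear_combination h2
    exact (pow_left_inj₀ (by nlinarith [mul_self_nonneg c, mul_self_nonneg e]) (by norm_num)
      (by omega)).1 h4
  have hc : c ∣ 1 := by
    have h5 : (⟨c, e⟩ : GaussianInt) - ⟨0, e⟩ ∣ ⟨c, e⟩ ^ n - ⟨0, e⟩ ^ n := sub_dvd_pow_sub_pow _ _ _
    have h6 : (⟨c, e⟩ : GaussianInt) - ⟨0, e⟩ = (c : GaussianInt) := by
      rw [Zsqrtd.ext_iff]; simp
    rw [h6, hu, Zsqrtd.intCast_dvd] at h5
    have h7 : ((⟨0, e⟩ : GaussianInt) ^ n).re = 0 := by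
      obtain ⟨k, rfl⟩ := hn
      have : (⟨0, e⟩ : GaussianInt) ^ 2 = ((-(e * e) : ℤ) : GaussianInt) := by
        rw [pow_two, Zsqrtd.ext_iff]; simp
      rw [pow_succ, pow_mul, this, ← Int.cast_pow, Zsqrtd.re_mul, Zsqrtd.re_intCast,
          Zsqrtd.im_intCast]
      ring
    have := h5.1
    simpa [h7] using this
  have hc1 : c = 1 ∨ c = -1 := Int.isUnit_iff.1 (isUnit_of_dvd_one hc)
  have he : e = 4 ∨ e = -4 := by
    have : (e - 4) * (e + 4) = 0 := by rcases hc1 with rfl | rfl <;> linarith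
    rcases mul_eq_zero.1 this with h | h <;> omega
  rcases hc1 with rfl | rfl
  · exact re_pow_ne_one he hn h1 (by rw [hu])
  · have h8 : (⟨-1, e⟩ : GaussianInt) = -⟨1, -e⟩ := by rw [Zsqrtd.ext_iff]; simp
    rw [h8, hn.neg_pow] at hu
    have h9 := (re_pow_emod_four (e := -e) (by omega) n).1
    have h10 := congrArg Zsqrtd.re hu
    simp only [Zsqrtd.re_neg] at h10
    omega

theorem eq_one_or_two_or_four_of_coprime_mul {a b q m : ℕ} (hq : q.Prime) (hab : a.Coprime b)
    (h : a * b = 4 * q ^ m) : (a ∣ 4) ∨ (b ∣ 4) := by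
  by_cases hqa : q ∣ a
  · right
    have hqb : (q ^ m).Coprime b :=
      (((Nat.Prime.coprime_iff_not_dvd hq).2 fun hb =>
        hq.one_lt.ne' (Nat.eq_one_of_dvd_coprimes hab hqa hb)).pow_left m)
    exact hqb.symm.dvd_of_dvd_mul_right (Dvd.intro_left a h)
  · left
    have hqa' : (q ^ m).Coprime a := ((Nat.Prime.coprime_iff_not_dvd hq).2 hqa).pow_left m
    exact hqa'.symm.dvd_of_dvd_mul_right (Dvd.intro b h)

theorem sixteen_mul_pow_add_one_ne_sq {p : ℤ} {m : ℕ} (hp : p.natAbs.Prime) (hm : 1 < m) (y : ℤ) :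
    16 * p ^ m + 1 ≠ y ^ 2 := by
  intro h
  obtain ⟨w, hw⟩ : Odd y := by
    rw [← Int.odd_pow' (n := 2) (by norm_num), ← h]
    exact ⟨8 * p ^ m, by ring⟩
  have h1 : w * (w + 1) = 4 * p ^ m := by
    rw [hw] at h; nlinarith
  have h2 : w.natAbs * (w + 1).natAbs = 4 * p.natAbs ^ m := by
    rw [← Int.natAbs_mul, h1, Int.natAbs_mul, Int.natAbs_pow]; rfl
  have hcop : w.natAbs.Coprime (w + 1).natAbs := by
    rw [← Int.isCoprime_iff_nat_coprime]
    exact ⟨-1, 1, by ring⟩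
  have hnp : ¬ (p.natAbs ^ m).Prime := Nat.Prime.not_prime_pow hm
  have hpos : 0 < p.natAbs ^ m := pow_pos hp.pos m
  have n3 : p.natAbs ^ m ≠ 3 := fun h => hnp (h ▸ Nat.prime_three)
  have n5 : p.natAbs ^ m ≠ 5 := fun h => hnp (h ▸ Nat.prime_five)
  have key : w.natAbs ∣ 4 ∨ (w + 1).natAbs ∣ 4 := eq_one_or_two_or_four_of_coprime_mul hp hcop h2
  have hw5 : -5 ≤ w ∧ w ≤ 4 := by
    rcases key with h | h <;> have := Nat.le_of_dvd (by norm_num) h <;> omega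
  obtain ⟨ha, hb⟩ := hw5
  have h3 : (p ^ m).natAbs = p.natAbs ^ m := Int.natAbs_pow _ _
  interval_cases w <;> omega

theorem odd_geom_sum_of_odd {y : ℤ} (hy : Odd y) {n : ℕ} (hn : Odd n) :
    Odd (∑ i ∈ Finset.range n, y ^ i) := by
  have h1 : (2 : ℤ) ∣ ∑ i ∈ Finset.range n, (y ^ i - 1) :=
    Finset.dvd_sum fun i _ => ((hy.pow).sub_odd odd_one).two_dvd
  rw [Finset.sum_sub_distrib] at h1
  simp only [Finset.sum_const, Finset.card_range, nsmul_eq_mul, mul_one] at h1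
  obtain ⟨k, rfl⟩ := hn
  rw [Int.odd_iff]
  push_cast at h1
  omega

/-- A solution with odd prime `n` has base `17`. -/
theorem eq_seventeen_of_sixteen_mul_pow_add_one_eq {p y : ℤ} {m n : ℕ} (hp : p.natAbs.Prime)
    (hn : n.Prime) (hn2 : n ≠ 2) (h : 16 * p ^ m + 1 = y ^ n) : y = 17 ∨ y = -15 := by
  have hodd : Odd n := hn.odd_of_ne_two hn2
  have hyodd : Odd y := by
    rw [← Int.odd_pow' (n := n) hn.ne_zero, ← h]
    exact ⟨8 * p ^ m, by ring⟩
  set Φ := ∑ i ∈ Finset.range n, y ^ i with hΦ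
  have hgeom : Φ * (y - 1) = 16 * p ^ m := by
    rw [hΦ, geom_sum_mul]; linarith
  have hΦodd : Odd Φ := odd_geom_sum_of_odd hyodd hodd
  have h16 : (16 : ℤ) ∣ y - 1 := by
    have hc : IsCoprime (16 : ℤ) Φ := by
      have : IsCoprime (2 : ℤ) Φ := (Int.isCoprime_two_left).2 hΦodd
      simpa using this.pow_left (m := 4)
    exact hc.dvd_of_dvd_mul_left ⟨p ^ m, hgeom⟩
  obtain ⟨D, hD⟩ := h16
  have hDΦ : D * Φ = p ^ m := by
    rw [hD] at hgeom; linarith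
  have hpp : Prime p := Int.prime_iff_natAbs_prime.2 hp
  have hD0 : D ≠ 0 := by
    rintro rfl
    exact pow_ne_zero m hpp.ne_zero (by simpa using hDΦ.symm)
  suffices hpD : ¬ p ∣ D by
    have hcop : IsCoprime (p ^ m) D := ((hpp.coprime_iff_not_dvd).2 hpD).pow_left
    have hDu : IsUnit D := hcop.symm.isUnit_of_dvd' dvd_rfl ⟨Φ, hDΦ.symm⟩
    rcases Int.isUnit_iff.1 hDu with rfl | rfl <;> omega
  intro hpD
  have hn3 : 3 ≤ n := by have := hn.two_le; omega
  have hbig : (n : ℤ) * |y - 1| < |y ^ n - 1| := by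
    have h14 : 15 ≤ |y| := by
      rcases lt_or_gt_of_ne hD0 with h | h
      · rw [abs_of_neg] <;> omega
      · rw [abs_of_pos] <;> omega
    have e1 : |y - 1| ≤ |y| + 1 := by simpa using abs_sub y 1
    have e2 : |y| ^ n - 1 ≤ |y ^ n - 1| := by
      have := abs_sub_abs_le_abs_sub (y ^ n) 1
      rwa [abs_pow, abs_one] at this
    have e3 : ∀ k : ℕ, ((k : ℤ) + 2) * (|y| + 1) + 1 < |y| ^ (k + 2) := by
      intro k
      generalize |y| = Y at h14
      induction k with
      | zero => push_cast; nlinarith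
      | succ k ih =>
        rw [pow_succ]
        push_cast
        have e5 : Y ^ (k + 2) * 15 ≤ Y ^ (k + 2) * Y := by gcongr
        have : 0 ≤ (k : ℤ) * (Y + 1) := by positivity
        nlinarith
    have e4 := e3 (n - 2)
    rw [Nat.sub_add_cancel hn.two_le] at e4
    push_cast [hn.two_le] at e4
    nlinarith
  rw [← geom_sum_mul, abs_mul] at hbig
  have hΦn : (n : ℤ) < |Φ| := lt_of_mul_lt_mul_right hbig (abs_nonneg _)
  have hpy : p ∣ y - 1 := hD ▸ hpD.mul_left 16
  have hΦdvd : Φ ∣ p ^ m := ⟨D, by rw [← hDΦ, mul_comm]⟩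
  obtain ⟨b, hb, hab⟩ := (dvd_prime_pow hpp m).1 hΦdvd
  have hb0 : b ≠ 0 := by
    rintro rfl
    have := Int.isUnit_iff_natAbs_eq.1 (hab.symm.isUnit (by simp : IsUnit (p ^ 0)))
    have : |Φ| = 1 := by rw [Int.abs_eq_natAbs, this]; rfl
    omega
  have hpΦ : p ∣ Φ := (dvd_pow_self p hb0).trans hab.symm.dvd
  have hpn : p ∣ n := by
    have e1 : p ∣ Φ - n := by
      have : Φ - n = ∑ i ∈ Finset.range n, (y ^ i - 1) := by
        rw [Finset.sum_sub_distrib]; simp [hΦ]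
      rw [this]
      refine Finset.dvd_sum fun i _ => hpy.trans ?_
      simpa using sub_dvd_pow_sub_pow y 1 i
    simpa using dvd_sub hpΦ e1
  have hpn' : p.natAbs = n := by
    have := Int.natAbs_dvd_natAbs.2 hpn
    exact (Nat.prime_dvd_prime_iff_eq hp hn).1 (by simpa using this)
  have hny : (n : ℤ) ∣ y - 1 := by
    rw [← hpn']; exact Int.natAbs_dvd.2 hpy
  obtain ⟨c, hc⟩ := hny
  have hsq := odd_sq_dvd_geom_sum₂_sub (a := (1 : ℤ)) (b := c) hodd
  have hy1 : (1 : ℤ) + n * c = y := by linarith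
  simp only [hy1, one_pow, mul_one] at hsq
  rw [← hΦ] at hsq
  have hb1 : b = 1 := by
    by_contra hb1
    have h2 : p ^ 2 ∣ Φ := (pow_dvd_pow p (by omega)).trans hab.symm.dvd
    have h3 : ((n : ℤ)) ^ 2 ∣ Φ := by
      rw [← hpn', Int.natCast_natAbs, sq_abs]; exact h2
    have h4 : (n : ℤ) ^ 2 ∣ n := by simpa using dvd_sub h3 hsq
    have h5 : n ^ 2 ∣ n := by exact_mod_cast h4
    have := Nat.le_of_dvd hn.pos h5
    nlinarith
  subst hb1
  have : |Φ| = n := by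
    rw [Int.abs_eq_natAbs, Int.associated_iff_natAbs.1 hab, pow_one, hpn']
  omega

/-- The residue of `(17 ^ c - 1) / 16` modulo the prime `ℓ` is not an `r`-th power. -/
def nonPowerTest (r ℓ c : ℕ) : Bool :=
  ℓ % r == 1 && (17 ^ c % ℓ + ℓ - 1) % ℓ ≠ 0 &&
    ((17 ^ c % ℓ + ℓ - 1) ^ (ℓ / r) % ℓ ≠ 16 ^ (ℓ / r) % ℓ)

theorem nonPowerTest_ne_true {r n y ℓ c : ℕ} (hr : 1 < r) (hℓ : ℓ.Prime)
    (hc : 17 ^ n ≡ 17 ^ c [MOD ℓ]) (h : 17 ^ n = 1 + 16 * y ^ r) :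
    nonPowerTest r ℓ c ≠ true := by
  intro ht
  simp only [nonPowerTest, Bool.and_eq_true, beq_iff_eq, decide_eq_true_eq] at ht
  obtain ⟨⟨h1, h2⟩, h3⟩ := ht
  have := Fact.mk hℓ
  have e1 : ℓ - 1 = r * (ℓ / r) := by
    have := Nat.div_add_mod ℓ r; omega
  have e2 : (17 : ZMod ℓ) ^ c = 1 + 16 * y ^ r := by
    have e3 := (ZMod.natCast_eq_natCast_iff _ _ _).2 hc
    have e4 := congrArg (Nat.cast : ℕ → ZMod ℓ) h
    push_cast at e3 e4
    rw [← e3, e4]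
  have e5 : (((17 ^ c % ℓ + ℓ - 1 : ℕ)) : ZMod ℓ) = 16 * y ^ r := by
    rw [Nat.cast_sub (by have := hℓ.pos; omega)]
    push_cast
    rw [ZMod.natCast_mod]
    push_cast
    rw [e2, ZMod.natCast_self]; ring
  by_cases hy : (y : ZMod ℓ) = 0
  · apply h2
    rw [hy, zero_pow (by omega), mul_zero, ZMod.natCast_eq_zero_iff] at e5
    exact Nat.mod_eq_zero_of_dvd e5
  · apply h3
    rw [← Nat.ModEq, ← ZMod.natCast_eq_natCast_iff]
    rw [Nat.cast_pow, e5, mul_pow, ← pow_mul, ← e1, ZMod.pow_card_sub_one_eq_one hy]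
    push_cast
    ring

theorem mod_eq_one_of_sieve {r n y : ℕ} (f : ℕ) (ls : List ℕ) (hls : ∀ ℓ ∈ ls, ℓ.Prime)
    (hord : ∀ ℓ ∈ ls, 17 ^ (r * f) % ℓ = 1)
    (htest : ∀ c < r * f, c.Coprime (r * f) → c % r ≠ 1 → ∃ ℓ ∈ ls, nonPowerTest r ℓ c = true)
    (hf : f ∣ 12) (hr : r.Prime) (hr3 : 3 ≤ r) (hn : n.Prime) (hrn : r < n)
    (h : 17 ^ n = 1 + 16 * y ^ r) : n % r = 1 := by
  by_contra hne
  have hf0 : 0 < f := Nat.pos_of_dvd_of_pos hf (by norm_num)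
  have hM : 0 < r * f := Nat.mul_pos hr.pos hf0
  have hcop : n.Coprime (r * f) := by
    refine Nat.Coprime.mul_right ((Nat.coprime_primes hn hr).2 hrn.ne') ?_
    refine Nat.Coprime.coprime_dvd_right hf ?_
    rw [show 12 = 2 ^ 2 * 3 by norm_num]
    refine Nat.Coprime.mul_right (Nat.Coprime.pow_right 2 ?_) ?_
    · exact (Nat.coprime_primes hn Nat.prime_two).2 (by omega)
    · exact (Nat.coprime_primes hn Nat.prime_three).2 (by omega)
  obtain ⟨ℓ, hℓ, ht⟩ := htest (n % (r * f)) (Nat.mod_lt _ hM)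
    (by rw [Nat.Coprime, ← Nat.gcd_rec]; exact hcop.symm)
    (by rwa [Nat.mod_mul_right_mod])
  refine nonPowerTest_ne_true (by omega) (hls ℓ hℓ) ?_ h ht
  have h1 : 17 ^ (r * f) ≡ 1 [MOD ℓ] := by
    have h2 := hord ℓ hℓ
    rw [Nat.ModEq, h2, Nat.mod_eq_of_lt (hls ℓ hℓ).one_lt]
  have h3 := (h1.pow (n / (r * f))).mul_right (17 ^ (n % (r * f)))
  rwa [← pow_mul, ← pow_add, Nat.div_add_mod, one_pow, one_mul] at h3

/-- Finitely many exponents `n = 1 + 2 * r * j` are excluded by a list of primes. -/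
theorem lt_of_sieve {r n y : ℕ} (ls : List ℕ) (J : ℕ) (hls : ∀ ℓ ∈ ls, ℓ.Prime)
    (htest : ∀ j < J, ∃ ℓ ∈ ls, nonPowerTest r ℓ (1 + 2 * r * (j + 1)) = true)
    (hr : 1 < r) (hr2 : r % 2 = 1) (hn1 : 1 < n) (hn2 : n % 2 = 1) (hnr : n % r = 1)
    (h : 17 ^ n = 1 + 16 * y ^ r) : 1 + 2 * r * J < n := by
  by_contra! hle
  obtain ⟨k, hk⟩ : 2 * r ∣ n - 1 := by
    refine Nat.Coprime.mul_dvd_of_dvd_of_dvd ?_ (by omega) ?_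
    · rw [Nat.coprime_two_left, Nat.odd_iff]; exact hr2
    · exact ⟨n / r, by have := Nat.div_add_mod n r; omega⟩
  have hk0 : k ≠ 0 := by rintro rfl; omega
  have hkJ : k ≤ J := by
    have : 2 * r * k ≤ 2 * r * J := by omega
    exact Nat.le_of_mul_le_mul_left this (by omega)
  obtain ⟨ℓ, hℓ, ht⟩ := htest (k - 1) (by omega)
  refine nonPowerTest_ne_true hr (hls ℓ hℓ) ?_ h ht
  rw [Nat.sub_add_cancel (by omega), ← hk]
  rw [show 1 + (n - 1) = n by omega]

theorem sum_inv_prod_sub_eq_zero {ι : Type*} [DecidableEq ι] (s : Finset ι) (v : ι → ℝ)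
    (hv : Set.InjOn v s) (hs : 1 < s.card) :
    ∑ i ∈ s, 1 / ∏ j ∈ s.erase i, (v i - v j) = 0 := by
  have h := Lagrange.coeff_eq_sum (P := (1 : Polynomial ℝ)) hv (by
    rw [Polynomial.degree_one]; exact_mod_cast by omega)
  rw [Polynomial.coeff_one, if_neg (by omega)] at h
  simpa using h.symm

/-- The divided difference of `x ↦ exp (t * x)` over `n + 1` nodes which are at most `c` is
positive and at most `t ^ n * exp (t * c) / n!`. -/
theorem divided_difference_exp_bounds {ι : Type*} [DecidableEq ι] (v : ι → ℝ) (c : ℝ) (n : ℕ) :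
    ∀ s : Finset ι, s.card = n + 1 → Set.InjOn v s → (∀ i ∈ s, v i ≤ c) → ∀ t : ℝ, 0 < t →
      0 < ∑ i ∈ s, Real.exp (t * v i) / ∏ j ∈ s.erase i, (v i - v j) ∧
      ∑ i ∈ s, Real.exp (t * v i) / ∏ j ∈ s.erase i, (v i - v j)
        ≤ t ^ n * Real.exp (t * c) / n.factorial := by
  induction n with
  | zero =>
    intro s hs _ hc t ht
    obtain ⟨x, rfl⟩ := Finset.card_eq_one.mp hs
    have hx := hc x (by simp)
    simp only [Finset.sum_singleton, Finset.erase_singleton, Finset.prod_empty, div_one, pow_zero,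
      one_mul, Nat.factorial_zero, Nat.cast_one]
    exact ⟨Real.exp_pos _, Real.exp_le_exp.mpr (by nlinarith)⟩
  | succ n ih =>
    intro s hs hv hc t ht
    obtain ⟨x, hx⟩ : s.Nonempty := Finset.card_pos.mp (by omega)
    have hcard : (s.erase x).card = n + 1 := by rw [Finset.card_erase_of_mem hx]; omega
    have ih' := ih (s.erase x) hcard (hv.mono (by simp))
      (fun i hi => hc i (Finset.mem_of_mem_erase hi))
    set G : ℝ → ℝ := fun t => ∑ i ∈ s, Real.exp (t * (v i - v x)) / ∏ j ∈ s.erase i, (v i - v j)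
      with hG
    have hGt : ∀ t, ∑ i ∈ s, Real.exp (t * v i) / ∏ j ∈ s.erase i, (v i - v j)
        = Real.exp (t * v x) * G t := by
      intro t
      rw [hG, Finset.mul_sum]
      refine Finset.sum_congr rfl fun i _ => ?_
      rw [← mul_div_assoc, ← Real.exp_add]
      ring_nf
    set H : ℝ → ℝ := fun t => Real.exp (-(t * v x)) *
      ∑ i ∈ s.erase x, Real.exp (t * v i) / ∏ j ∈ (s.erase x).erase i, (v i - v j) with hH
    have hderiv : ∀ t, HasDerivAt G (H t) t := by
      intro t
      have h1 : HasDerivAt G (∑ i ∈ s, Real.exp (t * (v i - v x)) * (1 * (v i - v x)) /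
          ∏ j ∈ s.erase i, (v i - v j)) t := by
        apply HasDerivAt.fun_sum
        intro i _
        exact (((hasDerivAt_id t).mul_const _).exp).div_const _
      convert h1 using 1
      rw [← Finset.add_sum_erase s _ hx]
      simp only [hH, Finset.mul_sum, sub_self, mul_zero, zero_div, zero_add]
      refine Finset.sum_congr rfl fun i hi => ?_
      have hne : v i - v x ≠ 0 := by
        rw [sub_ne_zero]
        exact fun h => Finset.ne_of_mem_erase hi (hv (Finset.mem_of_mem_erase hi) hx h)
      rw [← Finset.mul_prod_erase (s.erase i) (fun j => v i - v j) (a := x)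
        (Finset.mem_erase.mpr ⟨(Finset.ne_of_mem_erase hi).symm, hx⟩), Finset.erase_right_comm,
        ← mul_div_assoc, ← Real.exp_add]
      rw [show -(t * v x) + t * v i = t * (v i - v x) by ring, one_mul,
        mul_comm (v i - v x) (∏ j ∈ _, _), mul_div_mul_right _ _ hne]
    have hG0 : G 0 = 0 := by
      simpa [hG] using sum_inv_prod_sub_eq_zero s v hv (by omega)
    have hcont : Continuous G := continuous_iff_continuousAt.mpr fun t => (hderiv t).continuousAt
    have hGpos : 0 < G t := by
      have := strictMonoOn_of_deriv_pos (convex_Ici (0 : ℝ)) hcont.continuousOn (fun u hu => by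
        rw [(hderiv u).deriv]
        rw [interior_Ici] at hu
        exact mul_pos (Real.exp_pos _) (ih' u hu).1)
      have := this (Set.mem_Ici.mpr le_rfl) (Set.mem_Ici.mpr ht.le) ht
      rwa [hG0] at this
    have hGle : G t ≤ t ^ (n + 1) * Real.exp (t * (c - v x)) / (n + 1).factorial := by
      set K : ℝ → ℝ := fun t => t ^ (n + 1) * Real.exp (t * (c - v x)) / (n + 1).factorial - G t
        with hK
      have hKd : ∀ u, HasDerivAt K ((((n + 1 : ℕ) : ℝ) * u ^ n * Real.exp (u * (c - v x)) +
          u ^ (n + 1) * (Real.exp (u * (c - v x)) * (1 * (c - v x)))) / (n + 1).factorial - H u)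
          u := by
        intro u
        exact (((hasDerivAt_pow (n + 1) u).mul
          (((hasDerivAt_id u).mul_const _).exp)).div_const _).sub (hderiv u)
      have hmono := monotoneOn_of_deriv_nonneg (f := K) (convex_Ici (0 : ℝ))
        (continuous_iff_continuousAt.mpr fun t => (hKd t).continuousAt).continuousOn
        (fun u _ => (hKd u).differentiableAt.differentiableWithinAt) (fun u hu => by
          rw [interior_Ici] at hu
          have hu : 0 < u := hu
          rw [(hKd u).deriv]
          have h1 : H u ≤ u ^ n * Real.exp (u * (c - v x)) / n.factorial := by
            calc H u ≤ Real.exp (-(u * v x)) * (u ^ n * Real.exp (u * c) / n.factorial) :=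
                  mul_le_mul_of_nonneg_left (ih' u hu).2 (Real.exp_pos _).le
              _ = _ := by
                rw [show u * (c - v x) = -(u * v x) + u * c by ring, Real.exp_add]; ring
          have h2 : ((n + 1 : ℕ) : ℝ) * u ^ n * Real.exp (u * (c - v x)) / (n + 1).factorial
              = u ^ n * Real.exp (u * (c - v x)) / n.factorial := by
            rw [Nat.factorial_succ]
            push_cast
            field_simp
          have h3 : 0 ≤ u ^ (n + 1) * (Real.exp (u * (c - v x)) * (1 * (c - v x))) /
              ((n + 1).factorial : ℝ) := by
            have := hc x hx
            have : 0 ≤ c - v x := by linarith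
            positivity
          rw [add_div, h2]
          linarith)
      have h := hmono (Set.mem_Ici.mpr le_rfl) (Set.mem_Ici.mpr ht.le) ht.le
      simp only [hK, hG0] at h
      rw [zero_pow (by omega)] at h
      simp only [zero_mul, zero_div, sub_zero] at h
      linarith
    rw [hGt]
    refine ⟨mul_pos (Real.exp_pos _) hGpos, ?_⟩
    calc _ ≤ Real.exp (t * v x) *
          (t ^ (n + 1) * Real.exp (t * (c - v x)) / (n + 1).factorial) :=
        mul_le_mul_of_nonneg_left hGle (Real.exp_pos _).le
      _ = _ := by
        rw [show t * c = t * v x + t * (c - v x) by ring, Real.exp_add]; ring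

/-- The product of the `s` consecutive shifts `x - ν, x + 1 - ν, …`. -/
def shiftedProd (ν : ℝ) (x : ℤ) (s : ℕ) : ℝ := ∏ q ∈ Finset.range s, ((x : ℝ) + q - ν)

theorem shiftedProd_add (ν : ℝ) (x : ℤ) (s t : ℕ) :
    shiftedProd ν x (s + t) = shiftedProd ν x s * shiftedProd ν (x + s) t := by
  unfold shiftedProd
  rw [Finset.prod_range_add]
  congr 1
  refine Finset.prod_congr rfl fun q _ => ?_
  push_cast
  ring

theorem factorial_dvd_pow_mul_prod {r : ℕ} (hr : r.Prime) (x : ℤ) (s : ℕ) :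
    (s.factorial : ℤ) ∣ (r : ℤ) ^ padicValNat r s.factorial *
      ∏ q ∈ Finset.range s, ((r : ℤ) * (x + q) - 1) := by
  have := Fact.mk hr
  obtain ⟨m, hm⟩ := pow_padicValNat_dvd (p := r) (n := s.factorial)
  set e := padicValNat r s.factorial
  have hcop : IsCoprime (r : ℤ) (m : ℤ) := by
    rw [Nat.isCoprime_iff_coprime, hr.coprime_iff_not_dvd]
    rintro ⟨k, rfl⟩
    have h1 : r ^ (e + 1) ∣ s.factorial := ⟨k, by rw [hm, pow_succ]; ring⟩
    rw [padicValNat_dvd_iff_le (Nat.factorial_ne_zero s)] at h1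
    exact absurd h1 (by omega)
  obtain ⟨u, w, huw⟩ := hcop
  have h2 : (m : ℤ) ∣ ∏ q ∈ Finset.range s, ((r : ℤ) * (x + q) - 1) := by
    rw [← Int.modEq_zero_iff_dvd]
    have h3 : ∏ q ∈ Finset.range s, ((r : ℤ) * (x + q) - 1) ≡
        ∏ q ∈ Finset.range s, ((r : ℤ) * ((x - u) + q)) [ZMOD m] := by
      refine Int.ModEq.prod fun q _ => ?_
      rw [Int.modEq_iff_dvd]
      exact ⟨w, by linear_combination -huw⟩
    refine h3.trans ?_
    rw [Finset.prod_mul_distrib, Int.modEq_zero_iff_dvd]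
    refine Dvd.dvd.mul_left ?_ _
    refine dvd_trans ?_ (Nat.factorial_coe_dvd_prod s (x - u))
    rw [hm]
    push_cast
    exact dvd_mul_left _ _
  rw [hm]
  push_cast
  exact mul_dvd_mul_left _ h2

theorem exists_int_eq_pow_mul_shiftedProd {r : ℕ} (hr : r.Prime) (x : ℤ) (s : ℕ) :
    ∃ z : ℤ, (r : ℝ) ^ (s + padicValNat r s.factorial) *
      (shiftedProd (1 / r) x s / s.factorial) = z := by
  obtain ⟨z, hz⟩ := factorial_dvd_pow_mul_prod hr x s
  refine ⟨z, ?_⟩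
  have hr0 : (r : ℝ) ≠ 0 := by exact_mod_cast hr.ne_zero
  have h1 : (r : ℝ) ^ s * shiftedProd (1 / r) x s =
      ((∏ q ∈ Finset.range s, ((r : ℤ) * (x + q) - 1) : ℤ) : ℝ) := by
    unfold shiftedProd
    push_cast
    conv_lhs => rw [← Finset.card_range s, ← Finset.prod_const, Finset.card_range]
    rw [← Finset.prod_mul_distrib]
    refine Finset.prod_congr rfl fun q _ => ?_
    field_simp
  have h2 : (s.factorial : ℝ) ≠ 0 := by exact_mod_cast Nat.factorial_ne_zero s
  have h3 : ((r : ℝ) ^ padicValNat r s.factorial) *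
      ((∏ q ∈ Finset.range s, ((r : ℤ) * (x + q) - 1) : ℤ) : ℝ) = s.factorial * z := by
    exact_mod_cast hz
  rw [← h1] at h3
  rw [pow_add]
  field_simp
  linear_combination h3

theorem exists_int_eq_pow_mul_shiftedProd_mul {r : ℕ} (hr : r.Prime) {M : ℕ} (x y : ℤ)
    {s t : ℕ} (hst : s + t ≤ M) :
    ∃ z : ℤ, (r : ℝ) ^ (M + padicValNat r M.factorial) *
      (shiftedProd (1 / r) x s / s.factorial * (shiftedProd (1 / r) y t / t.factorial)) = z := by
  have := Fact.mk hr
  obtain ⟨z, hz⟩ := exists_int_eq_pow_mul_shiftedProd hr x s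
  obtain ⟨w, hw⟩ := exists_int_eq_pow_mul_shiftedProd hr y t
  have h1 : padicValNat r s.factorial + padicValNat r t.factorial ≤ padicValNat r M.factorial := by
    rw [← padicValNat.mul (Nat.factorial_ne_zero s) (Nat.factorial_ne_zero t)]
    rw [← padicValNat_dvd_iff_le (Nat.factorial_ne_zero M)]
    exact (pow_padicValNat_dvd.trans (Nat.factorial_mul_factorial_dvd_factorial_add s t)).trans
      (Nat.factorial_dvd_factorial hst)
  obtain ⟨d, hd⟩ : ∃ d, M + padicValNat r M.factorial =
      (s + padicValNat r s.factorial) + (t + padicValNat r t.factorial) + d :=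
    Nat.exists_eq_add_of_le (by omega)
  refine ⟨z * w * r ^ d, ?_⟩
  rw [hd, pow_add, pow_add]
  push_cast
  rw [← hz, ← hw]
  ring

theorem abs_shiftedProd_le_descFactorial {ν : ℝ} (h0 : 0 ≤ ν) (h1 : ν ≤ 1) {M s : ℕ}
    (hs : s ≤ M) : |shiftedProd ν (1 - M) s| ≤ M.descFactorial s := by
  unfold shiftedProd
  rw [Finset.abs_prod, Nat.descFactorial_eq_prod_range, Nat.cast_prod]
  refine Finset.prod_le_prod (fun _ _ => abs_nonneg _) fun q hq => ?_
  have hq : q + 1 ≤ M := by have := Finset.mem_range.mp hq; omega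
  have hq' : (q : ℝ) + 1 ≤ M := by exact_mod_cast hq
  rw [Nat.cast_sub (by omega)]
  push_cast
  rw [abs_le]
  constructor <;> linarith

theorem abs_shiftedProd_le_ascFactorial {ν : ℝ} (h0 : 0 ≤ ν) (h1 : ν ≤ 1) (x s : ℕ) :
    |shiftedProd ν (x + 1) s| ≤ (x + 1).ascFactorial s := by
  unfold shiftedProd
  rw [Finset.abs_prod, Nat.ascFactorial_eq_prod_range, Nat.cast_prod]
  refine Finset.prod_le_prod (fun _ _ => abs_nonneg _) fun q hq => ?_
  push_cast
  rw [abs_le]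
  have : (0 : ℝ) ≤ x := Nat.cast_nonneg x
  have : (0 : ℝ) ≤ q := Nat.cast_nonneg q
  constructor <;> linarith

theorem prod_range_erase_sub (M i : ℕ) (hi : i ≤ M) :
    ∏ j ∈ (Finset.range (M + 1)).erase i, ((i : ℝ) - j) =
      (-1) ^ (M - i) * (i.factorial * (M - i).factorial) := by
  obtain ⟨d, rfl⟩ := Nat.exists_eq_add_of_le hi
  have h1 : (Finset.range (i + d + 1)).erase i =
      (Finset.range i).disjUnion ((Finset.range d).map (addLeftEmbedding (i + 1))) (by
        rw [Finset.disjoint_left]; intro x hx; simp at hx ⊢; omega) := by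
    ext x
    simp only [Finset.mem_erase, Finset.mem_range, Finset.mem_disjUnion, Finset.mem_map,
      addLeftEmbedding_apply]
    constructor
    · intro h
      by_cases hx : x < i
      · exact Or.inl hx
      · exact Or.inr ⟨x - (i + 1), by omega, by omega⟩
    · rintro (h | ⟨y, h, rfl⟩) <;> omega
  rw [h1, Finset.prod_disjUnion, Finset.prod_map, Nat.add_sub_cancel_left]
  have h2 : ∏ j ∈ Finset.range i, ((i : ℝ) - j) = i.factorial := by
    rw [← Nat.descFactorial_self, Nat.descFactorial_eq_prod_range, Nat.cast_prod]
    refine Finset.prod_congr rfl fun j hj => ?_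
    rw [Nat.cast_sub (Finset.mem_range.mp hj).le]
  have h3 : ∏ j ∈ Finset.range d, ((i : ℝ) - (addLeftEmbedding (i + 1) j : ℕ)) =
      (-1) ^ d * d.factorial := by
    rw [← Finset.prod_range_add_one_eq_factorial, Nat.cast_prod]
    conv_rhs => rw [← Finset.card_range d, ← Finset.prod_const, Finset.card_range]
    rw [← Finset.prod_mul_distrib]
    refine Finset.prod_congr rfl fun j _ => ?_
    simp only [addLeftEmbedding_apply]
    push_cast
    ring
  rw [h2, h3]
  ring

theorem shiftedProd_ne_zero {ν : ℝ} (h0 : 0 < ν) (h1 : ν < 1) (x : ℤ) (s : ℕ) :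
    shiftedProd ν x s ≠ 0 := by
  unfold shiftedProd
  rw [Finset.prod_ne_zero_iff]
  intro q _ h
  have h2 : ((x + q : ℤ) : ℝ) = ν := by push_cast; linarith
  rw [← h2] at h0 h1
  have h3 : 0 < x + q := by exact_mod_cast h0
  have h4 : x + q < 1 := by exact_mod_cast h1
  omega

theorem prod_disjSum_erase_inl {f : ℕ ⊕ ℕ → ℝ} (m k i : ℕ) :
    ∏ x ∈ ((Finset.range m).disjSum (Finset.range k)).erase (Sum.inl i), f x =
      (∏ x ∈ (Finset.range m).erase i, f (Sum.inl x)) * ∏ x ∈ Finset.range k, f (Sum.inr x) := by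
  rw [← Finset.prod_disjSum]
  congr 1
  ext x
  cases x <;> simp

theorem prod_disjSum_erase_inr {f : ℕ ⊕ ℕ → ℝ} (m k h : ℕ) :
    ∏ x ∈ ((Finset.range m).disjSum (Finset.range k)).erase (Sum.inr h), f x =
      (∏ x ∈ Finset.range m, f (Sum.inl x)) * ∏ x ∈ (Finset.range k).erase h, f (Sum.inr x) := by
  rw [← Finset.prod_disjSum]
  congr 1
  ext x
  cases x <;> simp

theorem prod_range_sub_sub_sub (ν : ℝ) (z : ℤ) (k : ℕ) :
    ∏ h ∈ Finset.range (k + 1), ((z : ℝ) - (h + ν)) = shiftedProd ν (z - k) (k + 1) := by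
  unfold shiftedProd
  rw [← Finset.prod_range_reflect]
  refine Finset.prod_congr rfl fun q hq => ?_
  have hq : q ≤ k := by have := Finset.mem_range.mp hq; omega
  rw [show k + 1 - 1 - q = k - q by omega, Nat.cast_sub hq]
  push_cast
  ring

theorem prod_range_shift_sub (ν : ℝ) (j h m : ℕ) :
    ∏ i ∈ Finset.range m, ((h : ℝ) + ν - (i - j)) = (-1) ^ m * shiftedProd ν (-j - h) m := by
  unfold shiftedProd
  conv_rhs => rw [← Finset.card_range m, ← Finset.prod_const, Finset.card_range]
  rw [← Finset.prod_mul_distrib]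
  refine Finset.prod_congr rfl fun q _ => ?_
  push_cast
  ring

theorem neg_one_pow_mul_prod_range_shift_sub_neg {ν : ℝ} (h0 : 0 < ν) (h1 : ν < 1)
    {j h k : ℕ} (hh : h ≤ k) :
    (-1) ^ (k - h) * ∏ i ∈ Finset.range (k + 1 + j + 1), ((h : ℝ) + ν - (i - j)) < 0 := by
  rw [show k + 1 + j + 1 = (h + j + 1) + (k - h + 1) by omega, Finset.prod_range_add]
  have h2 : 0 < ∏ i ∈ Finset.range (h + j + 1), ((h : ℝ) + ν - (i - j)) := by
    refine Finset.prod_pos fun i hi => ?_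
    have : (i : ℝ) ≤ h + j := by
      have := Finset.mem_range.mp hi
      exact_mod_cast (by omega : i ≤ h + j)
    linarith
  have h3 : 0 < ∏ i ∈ Finset.range (k - h + 1), (((i : ℝ) + 1) - ν) := by
    refine Finset.prod_pos fun i _ => ?_
    have : (0 : ℝ) ≤ i := Nat.cast_nonneg i
    linarith
  have h4 : ∏ i ∈ Finset.range (k - h + 1), ((h : ℝ) + ν - (((h + j + 1 + i : ℕ) : ℝ) - j)) =
      (-1) ^ (k - h + 1) * ∏ i ∈ Finset.range (k - h + 1), (((i : ℝ) + 1) - ν) := by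
    conv_rhs => rw [← Finset.card_range (k - h + 1), ← Finset.prod_const, Finset.card_range]
    rw [← Finset.prod_mul_distrib]
    refine Finset.prod_congr rfl fun q _ => ?_
    push_cast
    ring
  rw [h4]
  have h5 : ((-1 : ℝ) ^ (k - h)) * (-1) ^ (k - h + 1) = -1 := by
    rw [pow_succ, ← mul_assoc, ← mul_pow]; simp
  have h6 := mul_pos h2 h3
  nlinarith [h5, h6]

theorem abs_shiftedProd_div_le_choose {ν : ℝ} (h0 : 0 ≤ ν) (h1 : ν ≤ 1) {M s : ℕ}
    (hs : s ≤ M) : |shiftedProd ν (1 - M) s / s.factorial| ≤ M.choose s := by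
  have h2 := abs_shiftedProd_le_descFactorial h0 h1 hs
  have h3 : (0 : ℝ) < s.factorial := by exact_mod_cast Nat.factorial_pos s
  rw [abs_div, abs_of_pos h3, div_le_iff₀ h3]
  refine h2.trans_eq ?_
  rw [Nat.descFactorial_eq_factorial_mul_choose]
  push_cast
  ring

theorem abs_shiftedProd_div_le_choose' {ν : ℝ} (h0 : 0 ≤ ν) (h1 : ν ≤ 1) (x s : ℕ) :
    |shiftedProd ν (x + 1) s / s.factorial| ≤ (x + s).choose s := by
  have h2 := abs_shiftedProd_le_ascFactorial h0 h1 x s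
  have h3 : (0 : ℝ) < s.factorial := by exact_mod_cast Nat.factorial_pos s
  rw [abs_div, abs_of_pos h3, div_le_iff₀ h3]
  refine h2.trans_eq ?_
  rw [Nat.ascFactorial_eq_factorial_mul_choose]
  push_cast
  ring

/-- A rational number `β = y / 17 ^ j` below `(17 / 16) ^ (1 / r)` cannot be too close to it:
Hermite–Padé approximation by divided differences of `x ↦ (17 / 16) ^ x` over the nodes
`-j, …, k + 1` and `1 / r, 1 / r + 1, …, 1 / r + k`. -/
theorem one_le_of_lt_exp_log_div {r j k M y : ℕ} (hr : r.Prime) (hM : M = k + 1 + j) {β : ℝ}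
    (hβ : β * 17 ^ j = y) (hβ' : β < Real.exp (Real.log (17 / 16) * (1 / r))) :
    1 ≤ (r : ℝ) ^ (M + padicValNat r M.factorial) * 16 ^ (k + 1) * 17 ^ j *
      (M.factorial * (k + 1).factorial * (Real.log (17 / 16) ^ (M + k + 1) * (17 / 16) ^ (k + 1) /
        (M + k + 1).factorial) + (Real.exp (Real.log (17 / 16) * (1 / r)) - β) *
          ((17 / 16) ^ k * (M + k + 1).choose k)) := by
  have hr1 : (1 : ℝ) < r := by exact_mod_cast hr.one_lt
  set ν : ℝ := 1 / r with hν
  have hν0 : 0 < ν := by positivity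
  have hν1 : ν < 1 := by rw [hν, div_lt_one (by linarith)]; exact hr1
  set L := Real.log (17 / 16) with hL
  have hL0 : 0 < L := Real.log_pos (by norm_num)
  have hexpL : Real.exp L = 17 / 16 := Real.exp_log (by norm_num)
  have hexpn : ∀ n : ℕ, Real.exp (L * n) = (17 / 16) ^ n := by
    intro n
    rw [mul_comm, Real.exp_nat_mul, hexpL]
  set s := (Finset.range (M + 1)).disjSum (Finset.range (k + 1)) with hs
  set v : ℕ ⊕ ℕ → ℝ := Sum.elim (fun i => (i : ℝ) - j) (fun h => (h : ℝ) + ν) with hv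
  have hinj : Set.InjOn v s := by
    rintro (i | i) hi (i' | i') hi' h
    · simp only [hv, Sum.elim_inl, sub_left_inj, Nat.cast_inj] at h
      rw [h]
    · exfalso
      simp only [hv, Sum.elim_inl, Sum.elim_inr] at h
      have h2 : (((i : ℤ) - j - i' : ℤ) : ℝ) = ν := by push_cast; linarith
      rw [← h2] at hν0 hν1
      have h3 : 0 < (i : ℤ) - j - i' := by exact_mod_cast hν0
      have h4 : (i : ℤ) - j - i' < 1 := by exact_mod_cast hν1
      omega
    · exfalso
      simp only [hv, Sum.elim_inl, Sum.elim_inr] at h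
      have h2 : (((i' : ℤ) - j - i : ℤ) : ℝ) = ν := by push_cast; linarith
      rw [← h2] at hν0 hν1
      have h3 : 0 < (i' : ℤ) - j - i := by exact_mod_cast hν0
      have h4 : (i' : ℤ) - j - i < 1 := by exact_mod_cast hν1
      omega
    · simp only [hv, Sum.elim_inr, add_left_inj, Nat.cast_inj] at h
      rw [h]
  have hle : ∀ x ∈ s, v x ≤ ((k + 1 : ℕ) : ℝ) := by
    rintro (i | i) hi
    · rw [hs, Finset.inl_mem_disjSum, Finset.mem_range] at hi
      have : (i : ℝ) ≤ k + 1 + j := by exact_mod_cast (by omega : i ≤ k + 1 + j)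
      simp only [hv, Sum.elim_inl]
      push_cast
      linarith
    · rw [hs, Finset.inr_mem_disjSum, Finset.mem_range] at hi
      have : (i : ℝ) ≤ k := by exact_mod_cast (by omega : i ≤ k)
      simp only [hv, Sum.elim_inr]
      push_cast
      linarith
  have hcard : s.card = (M + k + 1) + 1 := by
    rw [hs, Finset.card_disjSum, Finset.card_range, Finset.card_range]; ring
  obtain ⟨hpos, hupper⟩ :=
    divided_difference_exp_bounds v ((k + 1 : ℕ) : ℝ) (M + k + 1) s hcard hinj hle L hL0
  rw [hexpn] at hupper
  set DD := ∑ x ∈ s, Real.exp (L * v x) / ∏ x' ∈ s.erase x, (v x - v x') with hDD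
  set P := shiftedProd ν (1 - M) (M + k + 1) with hP
  have hP0 : P ≠ 0 := shiftedProd_ne_zero hν0 hν1 _ _
  set A : ℕ → ℝ := fun i => (-1) ^ (M - i) * (shiftedProd ν (1 - M) i / i.factorial *
    (shiftedProd ν (i + k + 2 - M) (M - i) / (M - i).factorial)) with hA
  set B : ℕ → ℝ := fun h => (-1) ^ (k - h + (M + 1)) *
    (shiftedProd ν (1 - M) (k - h) / (k - h).factorial *
      (shiftedProd ν (((k - h + 1 : ℕ) : ℤ) + 1) h / h.factorial)) with hB
  have hsq : ∀ m : ℕ, ((-1 : ℝ) ^ m) * (-1) ^ m = 1 := by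
    intro m; rw [← mul_pow]; simp
  have hfac : ∀ m : ℕ, (m.factorial : ℝ) ≠ 0 := fun m => by exact_mod_cast Nat.factorial_ne_zero m
  have hωA : ∀ i ∈ Finset.range (M + 1),
      (∏ x' ∈ s.erase (Sum.inl i), (v (Sum.inl i) - v x')) * A i = P := by
    intro i hi
    have hi : i ≤ M := by have := Finset.mem_range.mp hi; omega
    rw [hs, prod_disjSum_erase_inl]
    simp only [hv, Sum.elim_inl, Sum.elim_inr, sub_sub_sub_cancel_right]
    rw [prod_range_erase_sub M i hi]
    have h1 := prod_range_sub_sub_sub ν ((i : ℤ) - j) k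
    push_cast at h1
    rw [h1, hP, show M + k + 1 = i + (k + 1) + (M - i) by omega, shiftedProd_add ν _ (i + (k + 1)),
      shiftedProd_add ν _ i (k + 1), hA]
    rw [show (1 - M + i : ℤ) = i - j - k by omega,
      show (1 - M + ((i + (k + 1) : ℕ) : ℤ)) = i + k + 2 - M by omega]
    have := hfac i
    have := hfac (M - i)
    field_simp
    linear_combination (shiftedProd ν (1 - M) i * shiftedProd ν (i - j - k) (k + 1) *
      shiftedProd ν (i + k + 2 - M) (M - i)) * hsq (M - i)
  have hωB' : ∀ h ∈ Finset.range (k + 1),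
      ∏ x' ∈ s.erase (Sum.inr h), (v (Sum.inr h) - v x') =
        (∏ i ∈ Finset.range (M + 1), ((h : ℝ) + ν - (i - j))) *
          ((-1) ^ (k - h) * (h.factorial * (k - h).factorial)) := by
    intro h hh
    have hh : h ≤ k := by have := Finset.mem_range.mp hh; omega
    rw [hs, prod_disjSum_erase_inr]
    simp only [hv, Sum.elim_inl, Sum.elim_inr, add_sub_add_right_eq_sub]
    rw [prod_range_erase_sub k h hh]
  have hωB : ∀ h ∈ Finset.range (k + 1),
      (∏ x' ∈ s.erase (Sum.inr h), (v (Sum.inr h) - v x')) * B h = P := by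
    intro h hh'
    have hh : h ≤ k := by have := Finset.mem_range.mp hh'; omega
    rw [hωB' h hh', prod_range_shift_sub, hP,
      show M + k + 1 = (k - h) + (M + 1) + h by omega, shiftedProd_add ν _ (k - h + (M + 1)),
      shiftedProd_add ν _ (k - h) (M + 1), hB]
    rw [show (1 - M + ((k - h : ℕ) : ℤ)) = -j - h by omega,
      show (1 - M + ((k - h + (M + 1) : ℕ) : ℤ)) = ((k - h + 1 : ℕ) : ℤ) + 1 by omega]
    have := hfac h
    have := hfac (k - h)
    beta_reduce
    rw [pow_add (-1 : ℝ) (k - h)]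
    field_simp
    linear_combination (shiftedProd ν (1 - M) (k - h) * shiftedProd ν (-j - h) (M + 1) *
      shiftedProd ν (((k - h + 1 : ℕ) : ℤ) + 1) h) *
        ((-1) ^ (M + 1) * (-1) ^ (M + 1) * hsq (k - h) + hsq (M + 1))
  have hωneg : ∀ h ∈ Finset.range (k + 1),
      ∏ x' ∈ s.erase (Sum.inr h), (v (Sum.inr h) - v x') < 0 := by
    intro h hh'
    have hh : h ≤ k := by have := Finset.mem_range.mp hh'; omega
    rw [hωB' h hh', hM]
    have h1 := neg_one_pow_mul_prod_range_shift_sub_neg hν0 hν1 (j := j) hh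
    have h2 : (0 : ℝ) < h.factorial * (k - h).factorial := by
      exact_mod_cast Nat.mul_pos (Nat.factorial_pos _) (Nat.factorial_pos _)
    nlinarith [mul_neg_of_neg_of_pos h1 h2]
  set γ := Real.exp (L * ν) with hγ
  -- the rational combination obtained by replacing `γ` with `β`
  set T := ∑ i ∈ Finset.range (M + 1), (17 / 16 : ℝ) ^ i / (17 / 16) ^ j * A i +
    ∑ h ∈ Finset.range (k + 1), (17 / 16 : ℝ) ^ h * β * B h with hT
  have hPDD : P * DD = ∑ i ∈ Finset.range (M + 1), (17 / 16 : ℝ) ^ i / (17 / 16) ^ j * A i +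
      ∑ h ∈ Finset.range (k + 1), (17 / 16 : ℝ) ^ h * γ * B h := by
    rw [hDD, Finset.mul_sum, hs, Finset.sum_disjSum, ← hs]
    congr 1
    · refine Finset.sum_congr rfl fun i hi => ?_
      have h1 := hωA i hi
      have h2 : ∏ x' ∈ s.erase (Sum.inl i), (v (Sum.inl i) - v x') ≠ 0 := by
        intro h0; rw [h0, zero_mul] at h1; exact hP0 h1.symm
      rw [← h1, mul_comm (∏ _ ∈ _, _), mul_assoc, mul_div_cancel₀ _ h2, mul_comm]
      simp only [hv, Sum.elim_inl]
      rw [mul_sub, Real.exp_sub, hexpn, hexpn]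
    · refine Finset.sum_congr rfl fun h hh => ?_
      have h1 := hωB h hh
      have h2 : ∏ x' ∈ s.erase (Sum.inr h), (v (Sum.inr h) - v x') ≠ 0 := (hωneg h hh).ne
      rw [← h1, mul_comm (∏ _ ∈ _, _), mul_assoc, mul_div_cancel₀ _ h2, mul_comm]
      simp only [hv, Sum.elim_inr]
      rw [mul_add, Real.exp_add, hexpn]
  have hTdiff : T = P * DD - (γ - β) * ∑ h ∈ Finset.range (k + 1), (17 / 16 : ℝ) ^ h * B h := by
    rw [hPDD, hT, Finset.mul_sum, add_sub_assoc, ← Finset.sum_sub_distrib]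
    congr 1
    refine Finset.sum_congr rfl fun h _ => ?_
    ring
  have hT0 : T ≠ 0 := by
    have h1 : ∑ h ∈ Finset.range (k + 1), (17 / 16 : ℝ) ^ h * B h = P *
        ∑ h ∈ Finset.range (k + 1), (17 / 16 : ℝ) ^ h /
          ∏ x' ∈ s.erase (Sum.inr h), (v (Sum.inr h) - v x') := by
      rw [Finset.mul_sum]
      refine Finset.sum_congr rfl fun h hh => ?_
      rw [← hωB h hh]
      have := (hωneg h hh).ne
      field_simp
    rw [hTdiff, h1, show P * DD - (γ - β) * (P * ∑ h ∈ Finset.range (k + 1), (17 / 16 : ℝ) ^ h /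
          ∏ x' ∈ s.erase (Sum.inr h), (v (Sum.inr h) - v x')) =
        P * (DD - (γ - β) * ∑ h ∈ Finset.range (k + 1), (17 / 16 : ℝ) ^ h /
          ∏ x' ∈ s.erase (Sum.inr h), (v (Sum.inr h) - v x')) by ring]
    refine mul_ne_zero hP0 (ne_of_gt ?_)
    have h2 : ∑ h ∈ Finset.range (k + 1), (17 / 16 : ℝ) ^ h /
          ∏ x' ∈ s.erase (Sum.inr h), (v (Sum.inr h) - v x') ≤ 0 :=
      Finset.sum_nonpos fun h hh => div_nonpos_of_nonneg_of_nonpos (by positivity) (hωneg h hh).le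
    nlinarith
  set D : ℝ := (r : ℝ) ^ (M + padicValNat r M.factorial) with hD
  have hD0 : 0 < D := by positivity
  have hint : ∃ z : ℤ, D * 16 ^ (k + 1) * 17 ^ j * T = z := by
    have hAint : ∀ i ∈ Finset.range (M + 1), ∃ z : ℤ,
        D * 16 ^ (k + 1) * 17 ^ j * ((17 / 16 : ℝ) ^ i / (17 / 16) ^ j * A i) = z := by
      intro i hi
      have hi : i ≤ M := by have := Finset.mem_range.mp hi; omega
      obtain ⟨z, hz⟩ := exists_int_eq_pow_mul_shiftedProd_mul hr (M := M) (1 - M) (i + k + 2 - M)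
        (s := i) (t := M - i) (by omega)
      refine ⟨(-1) ^ (M - i) * 16 ^ (M - i) * 17 ^ i * z, ?_⟩
      rw [← hν, ← hD] at hz
      push_cast
      rw [← hz, hA, div_pow, div_pow]
      have h16 : (16 : ℝ) ^ (k + 1) * 16 ^ j = 16 ^ (M - i) * 16 ^ i := by
        rw [← pow_add, ← pow_add]; congr 1; omega
      have key : (16 : ℝ) ^ (k + 1) * 17 ^ j * (17 ^ i / 16 ^ i / (17 ^ j / 16 ^ j)) =
          16 ^ (M - i) * 17 ^ i := by
        field_simp
        linear_combination h16
      beta_reduce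
      linear_combination (D * ((-1) ^ (M - i) * (shiftedProd ν (1 - M) i / i.factorial *
        (shiftedProd ν (i + k + 2 - M) (M - i) / (M - i).factorial)))) * key
    have hBint : ∀ h ∈ Finset.range (k + 1), ∃ z : ℤ,
        D * 16 ^ (k + 1) * 17 ^ j * ((17 / 16 : ℝ) ^ h * β * B h) = z := by
      intro h hh
      have hh : h ≤ k := by have := Finset.mem_range.mp hh; omega
      obtain ⟨z, hz⟩ := exists_int_eq_pow_mul_shiftedProd_mul hr (M := M) (1 - M)
        (((k - h + 1 : ℕ) : ℤ) + 1) (s := k - h) (t := h) (by omega)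
      refine ⟨(-1) ^ (k - h + (M + 1)) * 16 ^ (k + 1 - h) * 17 ^ h * y * z, ?_⟩
      rw [← hν, ← hD] at hz
      push_cast at hz ⊢
      rw [← hz, ← hβ, hB, div_pow]
      have h16 : (16 : ℝ) ^ (k + 1) = 16 ^ (k + 1 - h) * 16 ^ h := by
        rw [← pow_add]; congr 1; omega
      rw [h16]
      push_cast
      field_simp
    choose! zA hzA using hAint
    choose! zB hzB using hBint
    refine ⟨∑ i ∈ Finset.range (M + 1), zA i + ∑ h ∈ Finset.range (k + 1), zB h, ?_⟩
    push_cast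
    rw [hT, mul_add, Finset.mul_sum, Finset.mul_sum, Finset.sum_congr rfl hzA,
      Finset.sum_congr rfl hzB]
  obtain ⟨z, hz⟩ := hint
  have hone : 1 ≤ D * 16 ^ (k + 1) * 17 ^ j * |T| := by
    have h1 : z ≠ 0 := by
      rintro rfl
      rw [Int.cast_zero] at hz
      exact mul_ne_zero (by positivity) hT0 hz
    have h2 : (1 : ℝ) ≤ |(z : ℝ)| := by exact_mod_cast Int.one_le_abs h1
    rwa [← hz, abs_mul, abs_of_pos (by positivity : 0 < D * 16 ^ (k + 1) * 17 ^ j)] at h2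
  refine hone.trans (mul_le_mul_of_nonneg_left ?_ (by positivity))
  have hPabs : |P| ≤ M.factorial * (k + 1).factorial := by
    rw [hP, show M + k + 1 = M + (k + 1) by ring, shiftedProd_add, abs_mul]
    refine mul_le_mul ?_ ?_ (abs_nonneg _) (by positivity)
    · simpa [Nat.descFactorial_self] using
        abs_shiftedProd_le_descFactorial hν0.le hν1.le (le_refl M)
    · have := abs_shiftedProd_le_ascFactorial hν0.le hν1.le 0 (k + 1)
      rw [zero_add, Nat.one_ascFactorial] at this
      rwa [show (1 - M + (M : ℤ)) = ((0 : ℕ) : ℤ) + 1 by push_cast; ring]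
  have hBsum : |∑ h ∈ Finset.range (k + 1), (17 / 16 : ℝ) ^ h * B h| ≤
      (17 / 16) ^ k * (M + k + 1).choose k := by
    refine (Finset.abs_sum_le_sum_abs _ _).trans ?_
    rw [show M + k + 1 = (k + 1) + M by ring, Nat.add_choose_eq,
      Finset.Nat.sum_antidiagonal_eq_sum_range_succ_mk, Nat.cast_sum, Finset.mul_sum]
    refine Finset.sum_le_sum fun h hh => ?_
    have hh : h ≤ k := by have := Finset.mem_range.mp hh; omega
    rw [abs_mul, abs_of_pos (by positivity : (0 : ℝ) < (17 / 16) ^ h)]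
    refine mul_le_mul (pow_le_pow_right₀ (by norm_num) hh) ?_ (abs_nonneg _) (by positivity)
    rw [hB]
    simp only [abs_mul, abs_pow, abs_neg, abs_one, one_pow, one_mul]
    have h1 := abs_shiftedProd_div_le_choose hν0.le hν1.le (M := M) (s := k - h) (by omega)
    have h2 := abs_shiftedProd_div_le_choose' hν0.le hν1.le (k - h + 1) h
    rw [show k - h + 1 + h = k + 1 by omega] at h2
    rw [mul_comm]
    push_cast
    push_cast at h2
    exact mul_le_mul h2 h1 (abs_nonneg _) (by positivity)
  rw [hTdiff]
  refine (abs_sub _ _).trans (add_le_add ?_ ?_)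
  · rw [abs_mul, abs_of_pos hpos]
    exact mul_le_mul hPabs hupper hpos.le (by positivity)
  · rw [abs_mul, abs_of_pos (by linarith)]
    exact mul_le_mul_of_nonneg_left hBsum (by linarith)

theorem pow_add_le_choose_mul_pow (a b : ℕ) :
    (a + b) ^ (a + b) ≤ (a + b + 1) * ((a + b).choose a * a ^ a * b ^ b) := by
  set t : ℕ → ℕ := fun i => (a + b).choose i * a ^ i * b ^ (a + b - i) with ht
  have hstep : ∀ i, i < a + b → (i + 1) * b * t (i + 1) = (a + b - i) * a * t i := by
    intro i hi
    have h1 := Nat.choose_succ_right_eq (a + b) i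
    simp only [ht]
    rw [show a + b - i = (a + b - (i + 1)) + 1 by omega] at h1 ⊢
    rw [pow_succ, pow_succ]
    linear_combination (a ^ i * a * b ^ (a + b - (i + 1)) * b) * h1
  have hlow : ∀ i d, i + d = a → t i ≤ t a := by
    intro i d
    induction d generalizing i with
    | zero => intro h; simp only [add_zero] at h; rw [h]
    | succ d ih =>
      intro h
      refine le_trans ?_ (ih (i + 1) (by omega))
      rcases Nat.eq_zero_or_pos b with hb | hb
      · simp only [ht, hb, add_zero]
        rw [zero_pow (by omega)]
        simp
      · have h1 := hstep i (by omega)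
        have h2 : (i + 1) * b ≤ (a + b - i) * a := by
          rw [mul_comm (a + b - i)]
          exact Nat.mul_le_mul (by omega) (by omega)
        have h3 : 0 < (i + 1) * b := by positivity
        refine Nat.le_of_mul_le_mul_left ?_ h3
        rw [h1]
        exact Nat.mul_le_mul_right _ h2
  have hhigh : ∀ d, a + d ≤ a + b → t (a + d) ≤ t a := by
    intro d
    induction d with
    | zero => intro _; rfl
    | succ d ih =>
      intro h
      refine le_trans ?_ (ih (by omega))
      have h1 := hstep (a + d) (by omega)
      have h2 : (a + b - (a + d)) * a ≤ (a + d + 1) * b := by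
        rw [mul_comm]
        exact Nat.mul_le_mul (by omega) (by omega)
      have h3 : 0 < (a + d + 1) * b := Nat.mul_pos (by omega) (by omega)
      refine Nat.le_of_mul_le_mul_left ?_ h3
      rw [← add_assoc, h1]
      exact Nat.mul_le_mul_right _ h2
  have hall : ∀ i ∈ Finset.range (a + b + 1), t i ≤ t a := by
    intro i hi
    have hi := Finset.mem_range.mp hi
    rcases le_total i a with h | h
    · exact hlow i (a - i) (by omega)
    · obtain ⟨d, rfl⟩ := Nat.exists_eq_add_of_le h
      exact hhigh d (by omega)
  have hsum := Finset.sum_le_card_nsmul _ _ _ hall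
  have hta : t a = (a + b).choose a * a ^ a * b ^ b := by
    simp only [ht, Nat.add_sub_cancel_left]
  rw [Finset.card_range, smul_eq_mul, hta] at hsum
  refine le_trans (le_of_eq ?_) hsum
  rw [add_pow]
  refine Finset.sum_congr rfl fun i _ => ?_
  simp only [ht]
  push_cast
  ring

theorem choose_mul_pow_le_pow (u v n i : ℕ) (hi : i ≤ n) :
    n.choose i * u ^ i * v ^ (n - i) ≤ (u + v) ^ n := by
  rw [add_pow]
  refine le_trans (le_of_eq ?_) (Finset.single_le_sum
    (f := fun i => u ^ i * v ^ (n - i) * (n.choose i : ℕ)) (fun _ _ => Nat.zero_le _)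
    (Finset.mem_range.mpr (Nat.lt_succ_of_le hi)))
  ring

theorem log_seventeen_div_sixteen_le : Real.log (17 / 16) ≤ 607 / 10000 := by
  rw [Real.log_le_iff_le_exp (by norm_num)]
  refine le_trans ?_ (Real.quadratic_le_exp_of_nonneg (by norm_num))
  norm_num

theorem pow_add_padicValNat_factorial_le {r M : ℕ} (hr : r.Prime) {R : ℝ} (hR : 0 ≤ R)
    (hrR : (r : ℝ) ^ r ≤ R ^ (r - 1)) :
    (r : ℝ) ^ (M + padicValNat r M.factorial) ≤ R ^ M := by
  have := Fact.mk hr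
  have h1 : (r - 1) * padicValNat r M.factorial ≤ M := by
    rw [sub_one_mul_padicValNat_factorial]
    exact Nat.sub_le _ _
  have hr1 : (1 : ℝ) ≤ r := by exact_mod_cast hr.one_lt.le
  have hr2 := hr.two_le
  refine le_of_pow_le_pow_left₀ (n := r - 1) (by omega) (by positivity) ?_
  calc ((r : ℝ) ^ (M + padicValNat r M.factorial)) ^ (r - 1)
      = r ^ ((r - 1) * M + (r - 1) * padicValNat r M.factorial) := by
        rw [← pow_mul]; ring_nf
    _ ≤ r ^ (r * M) := by
        refine pow_le_pow_right₀ hr1 ?_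
        obtain ⟨q, rfl⟩ : ∃ q, r = q + 1 := ⟨r - 1, by omega⟩
        simp only [Nat.add_sub_cancel] at h1 ⊢
        nlinarith
    _ = (r ^ r) ^ M := by rw [pow_mul]
    _ ≤ (R ^ (r - 1)) ^ M := pow_le_pow_left₀ (by positivity) hrR _
    _ = _ := by rw [← pow_mul, ← pow_mul, mul_comm]

theorem one_le_of_seventeen_pow_eq {r j k M y : ℕ} (hr : r.Prime) (hM : M = k + 1 + j)
    (h : 17 ^ (r * j + 1) = 1 + 16 * y ^ r) :
    1 ≤ (r : ℝ) ^ (M + padicValNat r M.factorial) * 17 ^ M *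
      (Real.log (17 / 16) ^ (M + k + 1) / (M + k + 1).choose (k + 1) +
        (M + k + 1).choose k / 17 ^ (r * j + 1)) := by
  set γ := Real.exp (Real.log (17 / 16) * (1 / r)) with hγ
  have hr0 : (r : ℝ) ≠ 0 := by exact_mod_cast hr.ne_zero
  have hr1 := hr.one_lt
  have hγr : γ ^ r = 17 / 16 := by
    rw [hγ, ← Real.exp_nat_mul, show (r : ℝ) * (Real.log (17 / 16) * (1 / r)) =
      Real.log (17 / 16) by field_simp, Real.exp_log (by norm_num)]
  have hγ1 : 1 ≤ γ := by
    rw [hγ, Real.one_le_exp_iff]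
    have : 0 < Real.log (17 / 16) := Real.log_pos (by norm_num)
    positivity
  set β : ℝ := y / 17 ^ j with hβ
  have hβ0 : 0 ≤ β := by positivity
  have hβr : γ ^ r - β ^ r = 17 / (16 * 17 ^ (r * j + 1)) := by
    have h' : (17 : ℝ) ^ (r * j + 1) = 1 + 16 * y ^ r := by exact_mod_cast h
    rw [hγr, hβ, div_pow, ← pow_mul, mul_comm j r]
    rw [pow_succ] at h' ⊢
    field_simp
    linear_combination h'
  have hlt : β < γ := by
    refine lt_of_pow_lt_pow_left₀ r (by linarith) ?_
    have : (0 : ℝ) < 17 / (16 * 17 ^ (r * j + 1)) := by positivity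
    linarith
  have hdiff : γ - β ≤ 17 / (16 * 17 ^ (r * j + 1)) := by
    rw [← hβr]
    obtain ⟨q, hq⟩ : ∃ q, r = q + 1 := ⟨r - 1, by omega⟩
    rw [hq, pow_succ, pow_succ]
    have h1 : β ^ q ≤ γ ^ q := pow_le_pow_left₀ hβ0 hlt.le q
    have h2 : 1 ≤ γ ^ q := one_le_pow₀ hγ1
    nlinarith [mul_le_mul_of_nonneg_right h1 hβ0]
  have hmain := one_le_of_lt_exp_log_div hr hM (β := β) (y := y) (by rw [hβ]; field_simp) hlt
  rw [← hγ] at hmain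
  refine hmain.trans ?_
  set D := (r : ℝ) ^ (M + padicValNat r M.factorial)
  have hD : 0 ≤ D := by positivity
  have h17 : (16 : ℝ) ^ (k + 1) * 17 ^ j * (17 / 16) ^ (k + 1) = 17 ^ M := by
    rw [hM, pow_add 17 (k + 1) j, div_pow]; field_simp
  have hchoose : ((M + k + 1).choose (k + 1) : ℝ) * (M.factorial * (k + 1).factorial) =
      (M + k + 1).factorial := by
    have := Nat.add_choose_mul_factorial_mul_factorial M (k + 1)
    rw [← add_assoc] at this
    have h2 : ((M + k + 1).choose (k + 1)) * (M.factorial * (k + 1).factorial) =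
      (M + k + 1).factorial := by rw [← this]; ring
    exact_mod_cast h2
  have hch0 : ((M + k + 1).choose (k + 1) : ℝ) ≠ 0 := by
    exact_mod_cast (Nat.choose_pos (by omega)).ne'
  have hf0 : ((M.factorial : ℝ) * (k + 1).factorial) ≠ 0 := by
    exact_mod_cast (Nat.mul_pos (Nat.factorial_pos _) (Nat.factorial_pos _)).ne'
  have e1 : D * 16 ^ (k + 1) * 17 ^ j * ((M.factorial : ℝ) * (k + 1).factorial *
      (Real.log (17 / 16) ^ (M + k + 1) * (17 / 16) ^ (k + 1) / (M + k + 1).factorial)) =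
      D * 17 ^ M * (Real.log (17 / 16) ^ (M + k + 1) / (M + k + 1).choose (k + 1)) := by
    rw [← h17, ← hchoose]
    generalize ((M.factorial : ℝ) * (k + 1).factorial) = f at hf0
    field_simp
  have e2 : D * 16 ^ (k + 1) * 17 ^ j * (17 / (16 * 17 ^ (r * j + 1)) *
      ((17 / 16) ^ k * ((M + k + 1).choose k : ℝ))) =
      D * 17 ^ M * ((M + k + 1).choose k / 17 ^ (r * j + 1)) := by
    rw [← h17, pow_succ (17 / 16 : ℝ) k]
    field_simp
  rw [mul_add, mul_add, e1, ← e2]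
  gcongr

theorem mul_add_one_le_mul_pow {L G : ℝ} (hL : 0 ≤ L) (hG : 1 ≤ G) (g : ℕ) :
    L * g + 1 ≤ G * (1 + L / G) ^ g := by
  have hG0 : (0 : ℝ) < G := by linarith
  have h1 := one_add_mul_le_pow (a := L / G) (by have : 0 ≤ L / G := by positivity
                                                 linarith) g
  calc L * g + 1 ≤ G * (1 + g * (L / G)) := by field_simp; nlinarith
    _ ≤ _ := mul_le_mul_of_nonneg_left h1 hG0.le

/-- Numerical form of the Hermite–Padé estimate, with numerator and denominator degrees in the
proportion `c : c + d`. -/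
theorem false_of_seventeen_pow_eq_of_numerics {r c d g₀ j y : ℕ} (hr : r.Prime) (hc : 0 < c)
    (hd : 0 < d) (R K G θ : ℝ) (hR : 0 ≤ R) (hrR : (r : ℝ) ^ r ≤ R ^ (r - 1)) (hK1 : 1 ≤ K)
    (hK : (17 * R * (607 / 10000)) ^ (d - 1) ≤ K) (hG : 1 ≤ G)
    (hθ : (17 * R) ^ (c + d) * (607 / 10000) ^ (2 * c + d) * (c ^ c * (c + d : ℕ) ^ (c + d)) *
      (1 + (2 * c + d : ℕ) / G) ≤ θ * (2 * c + d : ℕ) ^ (2 * c + d))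
    (hθ1 : θ ≤ 1) (hsmall : K * G * θ ^ g₀ ≤ 1 / 2)
    (hupper : (17 * R) ^ (c + d) * (2 * c + d : ℕ) ^ (2 * c + d) ≤
      c ^ c * (c + d : ℕ) ^ (c + d) * 17 ^ (r * d))
    (hrem : 17 * R * (2 * c + d : ℕ) ≤ (c + d : ℕ) * 17 ^ r)
    (hg₀ : 0 < g₀) (hj : d * g₀ ≤ j) (h : 17 ^ (r * j + 1) = 1 + 16 * y ^ r) : False := by
  obtain ⟨g, s, hs, hjg⟩ : ∃ g s, s < d ∧ j = d * g + s :=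
    ⟨j / d, j % d, Nat.mod_lt _ hd, (Nat.div_add_mod j d).symm⟩
  have hg : g₀ ≤ g := by
    by_contra hlt
    have : d * g + d ≤ d * g₀ := by
      rw [← Nat.mul_succ]; exact Nat.mul_le_mul_left _ (by omega)
    omega
  have hcg : 0 < c * g := Nat.mul_pos hc (by omega)
  obtain ⟨k, hk⟩ : ∃ k, c * g = k + 1 := ⟨c * g - 1, by omega⟩
  set M := k + 1 + j with hM
  have hMg : M = (c + d) * g + s := by rw [hM, ← hk, hjg]; ring
  have hNg : M + k + 1 = (2 * c + d) * g + s := by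
    rw [add_assoc, hMg, ← hk]; ring
  have hone := one_le_of_seventeen_pow_eq hr hM h
  have hD := pow_add_padicValNat_factorial_le (M := M) hr hR hrR
  set ε : ℝ := 607 / 10000 with hε
  have hε0 : 0 < ε := by rw [hε]; norm_num
  have hlog := log_seventeen_div_sixteen_le
  rw [← hε] at hlog
  clear_value ε
  have hlog0 : 0 ≤ Real.log (17 / 16) := Real.log_nonneg (by norm_num)
  set u : ℝ := ((2 * c + d : ℕ) : ℝ) with hu
  set w : ℝ := ((c + d : ℕ) : ℝ) with hw
  have hu0 : 0 < u := by rw [hu]; exact_mod_cast (by omega : 0 < 2 * c + d)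
  have hw0 : 0 < w := by rw [hw]; exact_mod_cast (by omega : 0 < c + d)
  have hc0 : (0 : ℝ) < c := by exact_mod_cast hc
  set W : ℝ := (c : ℝ) ^ c * w ^ (c + d) with hW
  have hW0 : 0 < W := by positivity
  have hWg : W ^ g = (c : ℝ) ^ (c * g) * w ^ ((c + d) * g) := by
    rw [hW, mul_pow, ← pow_mul, ← pow_mul]
  -- the main term
  have hbin : u ^ ((2 * c + d) * g) ≤
      (u * g + 1) * (((M + k + 1).choose (k + 1) : ℝ) * W ^ g) := by
    have h1 := pow_add_le_choose_mul_pow (c * g) ((c + d) * g)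
    have h2 : (c * g + (c + d) * g).choose (c * g) ≤ (M + k + 1).choose (k + 1) := by
      rw [← hk]
      refine Nat.choose_le_choose _ ?_
      rw [hNg]
      exact le_of_eq_of_le (by ring) (Nat.le_add_right _ s)
    have h3 : (((2 * c + d) * g) ^ ((2 * c + d) * g)) ≤ ((2 * c + d) * g + 1) *
        ((M + k + 1).choose (k + 1) * (c * g) ^ (c * g) * ((c + d) * g) ^ ((c + d) * g)) := by
      rw [show (2 * c + d) * g = c * g + (c + d) * g by ring]
      refine h1.trans ?_
      gcongr
    have h4 : (u * g) ^ ((2 * c + d) * g) ≤ (u * g + 1) *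
        ((M + k + 1).choose (k + 1) * ((c : ℝ) * g) ^ (c * g) * (w * g) ^ ((c + d) * g)) := by
      rw [hu, hw]; exact_mod_cast h3
    have hg0 : (0 : ℝ) < g := by exact_mod_cast (by omega : 0 < g)
    rw [mul_pow, mul_pow, mul_pow] at h4
    have h5 : (g : ℝ) ^ (c * g) * (g : ℝ) ^ ((c + d) * g) = (g : ℝ) ^ ((2 * c + d) * g) := by
      rw [← pow_add]; congr 1; ring
    refine le_of_mul_le_mul_right ?_ (pow_pos hg0 ((2 * c + d) * g))
    refine h4.trans (le_of_eq ?_)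
    rw [hWg, ← h5]
    ring
  have hch0 : (0 : ℝ) < (M + k + 1).choose (k + 1) := by
    exact_mod_cast Nat.choose_pos (by omega)
  have hs1 : (17 * R * ε) ^ s ≤ K := by
    rcases le_total (17 * R * ε) 1 with h1 | h1
    · exact (pow_le_one₀ (by positivity) h1).trans hK1
    · exact (pow_le_pow_right₀ h1 (by omega)).trans hK
  have hθ0 : 0 ≤ θ := by
    by_contra hneg
    have : θ * u ^ (2 * c + d) < 0 := mul_neg_of_neg_of_pos (not_le.mp hneg) (by positivity)
    have : 0 ≤ (17 * R) ^ (c + d) * ε ^ (2 * c + d) * W * (1 + u / G) := by positivity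
    linarith
  have hmainterm : R ^ M * 17 ^ M * (ε ^ (M + k + 1) / (M + k + 1).choose (k + 1)) ≤ 1 / 2 := by
    have h1 : 1 / ((M + k + 1).choose (k + 1) : ℝ) ≤
        (u * g + 1) * W ^ g / u ^ ((2 * c + d) * g) := by
      rw [div_le_div_iff₀ hch0 (by positivity)]
      linarith
    calc R ^ M * 17 ^ M * (ε ^ (M + k + 1) / (M + k + 1).choose (k + 1))
        = (17 * R) ^ M * ε ^ (M + k + 1) * (1 / (M + k + 1).choose (k + 1)) := by
          rw [mul_pow]; ring
      _ ≤ (17 * R) ^ M * ε ^ (M + k + 1) * ((u * g + 1) * W ^ g / u ^ ((2 * c + d) * g)) :=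
          mul_le_mul_of_nonneg_left h1 (by positivity)
      _ = (17 * R * ε) ^ s * (u * g + 1) *
          ((17 * R) ^ (c + d) * ε ^ (2 * c + d) * W / u ^ (2 * c + d)) ^ g := by
          rw [hNg, hMg, pow_add, pow_add, pow_mul, pow_mul, pow_mul, div_pow, mul_pow _ W,
            mul_pow ((17 * R) ^ (c + d)), mul_pow (17 * R) ε]
          ring
      _ ≤ K * (G * (1 + u / G) ^ g) *
          ((17 * R) ^ (c + d) * ε ^ (2 * c + d) * W / u ^ (2 * c + d)) ^ g := by
          have := mul_add_one_le_mul_pow hu0.le hG g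
          gcongr
      _ = K * G * ((17 * R) ^ (c + d) * ε ^ (2 * c + d) * W * (1 + u / G) /
          u ^ (2 * c + d)) ^ g := by
          rw [div_pow, div_pow, mul_pow _ (1 + u / G)]
          ring
      _ ≤ K * G * θ ^ g := by
          gcongr
          rw [div_le_iff₀ (by positivity)]
          exact hθ
      _ ≤ K * G * θ ^ g₀ :=
          mul_le_mul_of_nonneg_left (pow_le_pow_of_le_one hθ0 hθ1 hg) (by positivity)
      _ ≤ 1 / 2 := hsmall
  -- the remainder term
  have hrest : R ^ M * 17 ^ M * (((M + k + 1).choose k : ℝ) / 17 ^ (r * j + 1)) ≤ 1 / 17 := by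
    have h1 := choose_mul_pow_le_pow c (c + d) (M + k + 1) k (by omega)
    rw [show M + k + 1 - k = M + 1 by omega, show c + (c + d) = 2 * c + d by ring] at h1
    have h2 : ((M + k + 1).choose k : ℝ) * c ^ k * w ^ (M + 1) ≤ u ^ (M + k + 1) := by
      rw [hu, hw]; exact_mod_cast h1
    have hcw : (c : ℝ) ≤ w := by rw [hw]; exact_mod_cast Nat.le_add_right c d
    have h3 : ((M + k + 1).choose k : ℝ) * c ^ (k + 1) * w ^ M ≤ u ^ (M + k + 1) := by
      refine le_trans ?_ h2
      rw [pow_succ (c : ℝ), pow_succ w]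
      have : 0 ≤ ((M + k + 1).choose k : ℝ) * c ^ k * w ^ M := by positivity
      nlinarith
    have h4 : ((M + k + 1).choose k : ℝ) * (W ^ g * w ^ s) ≤ u ^ ((2 * c + d) * g) * u ^ s := by
      rw [hWg, ← pow_add u, ← hNg]
      refine le_trans (le_of_eq ?_) h3
      rw [hMg, pow_add, hk]
      ring
    have h5 : (17 * R) ^ M * (u ^ ((2 * c + d) * g) * u ^ s) ≤ W ^ g * w ^ s * 17 ^ (r * j) := by
      have h6 : ((17 * R) ^ (c + d) * u ^ (2 * c + d)) ^ g ≤ (W * 17 ^ (r * d)) ^ g :=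
        pow_le_pow_left₀ (by positivity) hupper g
      have h7 : (17 * R * u) ^ s ≤ (w * 17 ^ r) ^ s := pow_le_pow_left₀ (by positivity) hrem s
      have h8 := mul_le_mul h6 h7 (by positivity) (by positivity)
      refine le_trans (le_of_eq ?_) (h8.trans (le_of_eq ?_))
      · rw [hMg, pow_add, pow_mul, pow_mul, mul_pow _ (u ^ (2 * c + d)), mul_pow _ u]
        ring
      · rw [hjg, mul_add, pow_add, ← mul_assoc r d g, pow_mul 17 (r * d), pow_mul 17 r s, mul_pow,
          mul_pow]
        ring
    have h9 : (17 * R) ^ M * ((M + k + 1).choose k : ℝ) ≤ 17 ^ (r * j) := by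
      refine le_of_mul_le_mul_right ?_ (by positivity : 0 < W ^ g * w ^ s)
      calc (17 * R) ^ M * ((M + k + 1).choose k : ℝ) * (W ^ g * w ^ s)
          = (17 * R) ^ M * (((M + k + 1).choose k : ℝ) * (W ^ g * w ^ s)) := by ring
        _ ≤ (17 * R) ^ M * (u ^ ((2 * c + d) * g) * u ^ s) :=
            mul_le_mul_of_nonneg_left h4 (by positivity)
        _ ≤ _ := h5.trans (le_of_eq (by ring))
    rw [← mul_pow, mul_comm R, ← mul_div_assoc, div_le_div_iff₀ (by positivity) (by norm_num),
      pow_succ]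
    linarith
  have hfin : (r : ℝ) ^ (M + padicValNat r M.factorial) * 17 ^ M *
      (Real.log (17 / 16) ^ (M + k + 1) / (M + k + 1).choose (k + 1) +
        (M + k + 1).choose k / 17 ^ (r * j + 1)) ≤
      R ^ M * 17 ^ M * (ε ^ (M + k + 1) / (M + k + 1).choose (k + 1) +
        (M + k + 1).choose k / 17 ^ (r * j + 1)) := by
    gcongr
  rw [mul_add] at hfin
  linarith

/-- Primes up to `43` are excluded by the Hermite–Padé estimate. -/
theorem false_of_seventeen_pow_eq_of_le_forty_three {r n y : ℕ} (hr : r.Prime) (hr2 : r ≠ 2)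
    (hr17 : r ≠ 17) (hr43 : r ≤ 43) (hn : n.Prime) (hrn : r < n) (h : 17 ^ n = 1 + 16 * y ^ r) :
    False := by
  have hr3 : 3 ≤ r := by have := hr.two_le; omega
  have hodd : n % 2 = 1 := by have := hn.eq_two_or_odd; omega
  interval_cases r <;> first | omega | (exfalso; revert hr; norm_num; done) | skip
  · have h1 := mod_eq_one_of_sieve 2 [7] (by norm_num) (by decide +kernel)
      (by decide +kernel) (by norm_num) (by norm_num) (by norm_num) hn hrn h
    have h2 := lt_of_sieve [11827, 43] 28 (by norm_num) (by decide +kernel) (by norm_num)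
      (by norm_num) hn.one_lt hodd h1 h
    refine false_of_seventeen_pow_eq_of_numerics (r := 3) (c := 3) (d := 5) (g₀ := 11)
      (j := n / 3) (y := y) (by norm_num) (by norm_num) (by norm_num) (26/5) 830 30 (17/50)
      ?_ ?_ ?_ ?_ ?_ ?_ ?_ ?_ ?_ ?_ ?_ ?_ ?_ <;> first | norm_num; done | omega | skip
    rwa [show 3 * (n / 3) + 1 = n by omega]
  · have h1 := mod_eq_one_of_sieve 2 [11, 101] (by norm_num) (by decide +kernel)
      (by decide +kernel) (by norm_num) (by norm_num) (by norm_num) hn hrn h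
    have h2 := lt_of_sieve [131] 5 (by norm_num) (by decide +kernel) (by norm_num)
      (by norm_num) hn.one_lt hodd h1 h
    refine false_of_seventeen_pow_eq_of_numerics (r := 5) (c := 1) (d := 1) (g₀ := 8)
      (j := n / 5) (y := y) (by norm_num) (by norm_num) (by norm_num) (187/25) 1 15 (13/20)
      ?_ ?_ ?_ ?_ ?_ ?_ ?_ ?_ ?_ ?_ ?_ ?_ ?_ <;> first | norm_num; done | omega | skip
    rwa [show 5 * (n / 5) + 1 = n by omega]
  · have h1 := mod_eq_one_of_sieve 6 [43] (by norm_num) (by decide +kernel)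
      (by decide +kernel) (by norm_num) (by norm_num) (by norm_num) hn hrn h
    have h2 := lt_of_sieve [113] 5 (by norm_num) (by decide +kernel) (by norm_num)
      (by norm_num) hn.one_lt hodd h1 h
    refine false_of_seventeen_pow_eq_of_numerics (r := 7) (c := 2) (d := 1) (g₀ := 2)
      (j := n / 7) (y := y) (by norm_num) (by norm_num) (by norm_num) (969/100) 1 2 (9/20)
      ?_ ?_ ?_ ?_ ?_ ?_ ?_ ?_ ?_ ?_ ?_ ?_ ?_ <;> first | norm_num; done | omega | skip
    rwa [show 7 * (n / 7) + 1 = n by omega]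
  · have h1 := mod_eq_one_of_sieve 2 [23] (by norm_num) (by decide +kernel)
      (by decide +kernel) (by norm_num) (by norm_num) (by norm_num) hn hrn h
    have h2 := lt_of_sieve [617] 5 (by norm_num) (by decide +kernel) (by norm_num)
      (by norm_num) hn.one_lt hodd h1 h
    refine false_of_seventeen_pow_eq_of_numerics (r := 11) (c := 3) (d := 1) (g₀ := 2)
      (j := n / 11) (y := y) (by norm_num) (by norm_num) (by norm_num) (1399/100) 1 1 (33/50)
      ?_ ?_ ?_ ?_ ?_ ?_ ?_ ?_ ?_ ?_ ?_ ?_ ?_ <;> first | norm_num; done | omega | skip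
    rwa [show 11 * (n / 11) + 1 = n by omega]
  · have h1 := mod_eq_one_of_sieve 2 [53, 79] (by norm_num) (by decide +kernel)
      (by decide +kernel) (by norm_num) (by norm_num) (by norm_num) hn hrn h
    have h2 := lt_of_sieve [313] 5 (by norm_num) (by decide +kernel) (by norm_num)
      (by norm_num) hn.one_lt hodd h1 h
    refine false_of_seventeen_pow_eq_of_numerics (r := 13) (c := 4) (d := 1) (g₀ := 1)
      (j := n / 13) (y := y) (by norm_num) (by norm_num) (by norm_num) (161/10) 1 1 (9/25)
      ?_ ?_ ?_ ?_ ?_ ?_ ?_ ?_ ?_ ?_ ?_ ?_ ?_ <;> first | norm_num; done | omega | skip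
    rwa [show 13 * (n / 13) + 1 = n by omega]
  · have h1 := mod_eq_one_of_sieve 2 [229, 457] (by norm_num) (by decide +kernel)
      (by decide +kernel) (by norm_num) (by norm_num) (by norm_num) hn hrn h
    have h2 := lt_of_sieve [419] 5 (by norm_num) (by decide +kernel) (by norm_num)
      (by norm_num) hn.one_lt hodd h1 h
    refine false_of_seventeen_pow_eq_of_numerics (r := 19) (c := 6) (d := 1) (g₀ := 1)
      (j := n / 19) (y := y) (by norm_num) (by norm_num) (by norm_num) (1119/50) 1 1 (8/25)
      ?_ ?_ ?_ ?_ ?_ ?_ ?_ ?_ ?_ ?_ ?_ ?_ ?_ <;> first | norm_num; done | omega | skip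
    rwa [show 19 * (n / 19) + 1 = n by omega]
  · have h1 := mod_eq_one_of_sieve 6 [47, 139] (by norm_num) (by decide +kernel)
      (by decide +kernel) (by norm_num) (by norm_num) (by norm_num) hn hrn h
    have h2 := lt_of_sieve [277] 5 (by norm_num) (by decide +kernel) (by norm_num)
      (by norm_num) hn.one_lt hodd h1 h
    refine false_of_seventeen_pow_eq_of_numerics (r := 23) (c := 7) (d := 1) (g₀ := 1)
      (j := n / 23) (y := y) (by norm_num) (by norm_num) (by norm_num) (2653/100) 1 1 (49/100)
      ?_ ?_ ?_ ?_ ?_ ?_ ?_ ?_ ?_ ?_ ?_ ?_ ?_ <;> first | norm_num; done | omega | skip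
    rwa [show 23 * (n / 23) + 1 = n by omega]
  · have h1 := mod_eq_one_of_sieve 2 [59] (by norm_num) (by decide +kernel)
      (by decide +kernel) (by norm_num) (by norm_num) (by norm_num) hn hrn h
    have h2 := lt_of_sieve [929] 5 (by norm_num) (by decide +kernel) (by norm_num)
      (by norm_num) hn.one_lt hodd h1 h
    refine false_of_seventeen_pow_eq_of_numerics (r := 29) (c := 8) (d := 1) (g₀ := 3)
      (j := n / 29) (y := y) (by norm_num) (by norm_num) (by norm_num) (3271/100) 1 10 (23/100)
      ?_ ?_ ?_ ?_ ?_ ?_ ?_ ?_ ?_ ?_ ?_ ?_ ?_ <;> first | norm_num; done | omega | skip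
    rwa [show 29 * (n / 29) + 1 = n by omega]
  · have h1 := mod_eq_one_of_sieve 2 [373, 4093] (by norm_num) (by decide +kernel)
      (by decide +kernel) (by norm_num) (by norm_num) (by norm_num) hn hrn h
    have h2 := lt_of_sieve [1117] 5 (by norm_num) (by decide +kernel) (by norm_num)
      (by norm_num) hn.one_lt hodd h1 h
    refine false_of_seventeen_pow_eq_of_numerics (r := 31) (c := 9) (d := 1) (g₀ := 2)
      (j := n / 31) (y := y) (by norm_num) (by norm_num) (by norm_num) (869/25) 1 15 (9/50)
      ?_ ?_ ?_ ?_ ?_ ?_ ?_ ?_ ?_ ?_ ?_ ?_ ?_ <;> first | norm_num; done | omega | skip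
    rwa [show 31 * (n / 31) + 1 = n by omega]
  · have h1 := mod_eq_one_of_sieve 2 [149] (by norm_num) (by decide +kernel)
      (by decide +kernel) (by norm_num) (by norm_num) (by norm_num) hn hrn h
    have h2 := lt_of_sieve [1999] 5 (by norm_num) (by decide +kernel) (by norm_num)
      (by norm_num) hn.one_lt hodd h1 h
    refine false_of_seventeen_pow_eq_of_numerics (r := 37) (c := 12) (d := 1) (g₀ := 4)
      (j := n / 37) (y := y) (by norm_num) (by norm_num) (by norm_num) (4091/100) 1 10 (37/100)
      ?_ ?_ ?_ ?_ ?_ ?_ ?_ ?_ ?_ ?_ ?_ ?_ ?_ <;> first | norm_num; done | omega | skip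
    rwa [show 37 * (n / 37) + 1 = n by omega]
  · have h1 := mod_eq_one_of_sieve 2 [83, 1231] (by norm_num) (by decide +kernel)
      (by decide +kernel) (by norm_num) (by norm_num) (by norm_num) hn hrn h
    have h2 := lt_of_sieve [739] 5 (by norm_num) (by decide +kernel) (by norm_num)
      (by norm_num) hn.one_lt hodd h1 h
    refine false_of_seventeen_pow_eq_of_numerics (r := 41) (c := 13) (d := 1) (g₀ := 5)
      (j := n / 41) (y := y) (by norm_num) (by norm_num) (by norm_num) (4499/100) 1 50 (39/100)
      ?_ ?_ ?_ ?_ ?_ ?_ ?_ ?_ ?_ ?_ ?_ ?_ ?_ <;> first | norm_num; done | omega | skip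
    rwa [show 41 * (n / 41) + 1 = n by omega]
  · have h1 := mod_eq_one_of_sieve 2 [1549] (by norm_num) (by decide +kernel)
      (by decide +kernel) (by norm_num) (by norm_num) (by norm_num) hn hrn h
    have h2 := lt_of_sieve [1033] 5 (by norm_num) (by decide +kernel) (by norm_num)
      (by norm_num) hn.one_lt hodd h1 h
    refine false_of_seventeen_pow_eq_of_numerics (r := 43) (c := 14) (d := 1) (g₀ := 7)
      (j := n / 43) (y := y) (by norm_num) (by norm_num) (by norm_num) (4703/100) 1 100 (11/25)
      ?_ ?_ ?_ ?_ ?_ ?_ ?_ ?_ ?_ ?_ ?_ ?_ ?_ <;> first | norm_num; done | omega | skip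
    rwa [show 43 * (n / 43) + 1 = n by omega]

/-- Primes from `47` to `73` are excluded by bounds for linear forms in logarithms. -/
theorem false_of_seventeen_pow_eq_of_le_seventy_three {r n y : ℕ} (hr : r.Prime) (hr47 : 47 ≤ r)
    (hr73 : r ≤ 73) (hn : n.Prime) (hrn : r < n) (hy : (17 : ℤ) ∣ y - 1) (hy1 : 1 < y)
    (h : 17 ^ n = 1 + 16 * y ^ r) : False := by
  have hodd : n % 2 = 1 := by have := hn.eq_two_or_odd; omega
  interval_cases r <;> first | (exfalso; revert hr; norm_num; done) | skip
  · have h1 := mod_eq_one_of_sieve 6 [283, 144103] (by norm_num) (by decide +kernel)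
      (by decide +kernel) (by norm_num) (by norm_num) (by norm_num) hn hrn h
    have h2 := lt_of_sieve [1693] 17 (by norm_num) (by decide +kernel) (by norm_num)
      (by norm_num) hn.one_lt hodd h1 h
    have h3 := exponent_lt_of_forty_seven hy hy1 h
    omega
  · have h1 := mod_eq_one_of_sieve 2 [107] (by norm_num) (by decide +kernel)
      (by decide +kernel) (by norm_num) (by norm_num) (by norm_num) hn hrn h
    have h2 := lt_of_sieve [2969] 18 (by norm_num) (by decide +kernel) (by norm_num)
      (by norm_num) hn.one_lt hodd h1 h
    have h3 := exponent_lt_of_le_seventy_three hy hy1 h (by norm_num) (by norm_num)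
    omega
  · have h1 := mod_eq_one_of_sieve 2 [1063, 1889] (by norm_num) (by decide +kernel)
      (by decide +kernel) (by norm_num) (by norm_num) (by norm_num) hn hrn h
    have h2 := lt_of_sieve [2243] 17 (by norm_num) (by decide +kernel) (by norm_num)
      (by norm_num) hn.one_lt hodd h1 h
    have h3 := exponent_lt_of_le_seventy_three hy hy1 h (by norm_num) (by norm_num)
    omega
  · have h1 := mod_eq_one_of_sieve 4 [1831, 5857] (by norm_num) (by decide +kernel)
      (by decide +kernel) (by norm_num) (by norm_num) (by norm_num) hn hrn h
    have h2 := lt_of_sieve [2441] 16 (by norm_num) (by decide +kernel) (by norm_num)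
      (by norm_num) hn.one_lt hodd h1 h
    have h3 := exponent_lt_of_le_seventy_three hy hy1 h (by norm_num) (by norm_num)
    omega
  · have h1 := mod_eq_one_of_sieve 2 [7103] (by norm_num) (by decide +kernel)
      (by decide +kernel) (by norm_num) (by norm_num) (by norm_num) hn hrn h
    have h2 := lt_of_sieve [3083] 15 (by norm_num) (by decide +kernel) (by norm_num)
      (by norm_num) hn.one_lt hodd h1 h
    have h3 := exponent_lt_of_le_seventy_three hy hy1 h (by norm_num) (by norm_num)
    omega
  · have h1 := mod_eq_one_of_sieve 4 [569, 6959] (by norm_num) (by decide +kernel)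
      (by decide +kernel) (by norm_num) (by norm_num) (by norm_num) hn hrn h
    have h2 := lt_of_sieve [2699] 14 (by norm_num) (by decide +kernel) (by norm_num)
      (by norm_num) hn.one_lt hodd h1 h
    have h3 := exponent_lt_of_le_seventy_three hy hy1 h (by norm_num) (by norm_num)
    omega
  · have h1 := mod_eq_one_of_sieve 2 [293, 284117] (by norm_num) (by decide +kernel)
      (by decide +kernel) (by norm_num) (by norm_num) (by norm_num) hn hrn h
    have h2 := lt_of_sieve [3359] 14 (by norm_num) (by decide +kernel) (by norm_num)
      (by norm_num) hn.one_lt hodd h1 h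
    have h3 := exponent_lt_of_le_seventy_three hy hy1 h (by norm_num) (by norm_num)
    omega

theorem false_of_seventeen_pow_eq {r n y : ℕ} (hr : r.Prime) (hr2 : r ≠ 2) (hr17 : r ≠ 17)
    (hn : n.Prime) (hnr : r < n) (hy : (17 : ℤ) ∣ y - 1) (hy1 : 1 < y)
    (hyn : n ≠ 17 → 34 * n + 1 ≤ y) (h : 17 ^ n = 1 + 16 * y ^ r) : False := by
  by_cases h43 : r ≤ 43
  · exact false_of_seventeen_pow_eq_of_le_forty_three hr hr2 hr17 h43 hn hnr h
  have h79 : r < 79 := lt_seventy_nine hy (hyn (by omega)) hnr h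
  have h47 : 47 ≤ r := by
    by_contra!
    interval_cases r <;> revert hr <;> norm_num
  have h73 : r ≤ 73 := by
    by_contra!
    interval_cases r <;> revert hr <;> norm_num
  exact false_of_seventeen_pow_eq_of_le_seventy_three hr h47 h73 hn hnr hy hy1 h

theorem seventeen_pow_ne_one_add_sixteen_mul_prime_pow {n q m : ℕ} (hn : n.Prime) (hn2 : n ≠ 2)
    (hq : q.Prime) (hm : 1 < m) : 17 ^ n ≠ 1 + 16 * q ^ m := by
  intro h
  have hodd : Odd n := hn.odd_of_ne_two hn2
  have hn3 : 3 ≤ n := by have := hn.two_le; omega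
  rcases Nat.even_or_odd m with ⟨k, hk⟩ | hmodd
  · refine seventeen_pow_ne_one_add_sixteen_mul_sq hodd (by omega) ((q : ℤ) ^ k) ?_
    rw [← pow_mul, mul_two, ← hk]
    exact_mod_cast h
  obtain ⟨r, hr, hrm⟩ := Nat.exists_prime_and_dvd (n := m) (by omega)
  obtain ⟨s, rfl⟩ := hrm
  have hrodd : Odd r := (Nat.odd_mul.1 hmodd).1
  have hr2 : r ≠ 2 := by rintro rfl; exact absurd hrodd (by decide)
  have hs : s ≠ 0 := by rintro rfl; simp at hm
  have h' : 17 ^ n = 1 + 16 * (q ^ s) ^ r := by rw [h, ← pow_mul, mul_comm s r]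
  have hq2 : q ≠ 2 := by
    rintro rfl
    have h1 : 17 ^ n % 32 = 17 := by
      obtain ⟨k, rfl⟩ := hodd
      rw [pow_succ, pow_mul, Nat.mul_mod, Nat.pow_mod]
      norm_num
    have h2 : 2 ∣ 2 ^ (r * s) := dvd_pow_self 2 (by omega)
    omega
  have hqn : n ∣ q - 1 := by
    have := Fact.mk hq
    have := Fact.mk hn
    have h1 : (17 : ZMod q) ^ n = 1 := by
      have := congrArg (Nat.cast : ℕ → ZMod q) h
      push_cast at this
      simpa [hr.ne_zero, hs] using this
    have h17 : (17 : ZMod q) ≠ 0 := by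
      intro h0; rw [h0, zero_pow hn.ne_zero] at h1; exact zero_ne_one h1
    have hord : orderOf (17 : ZMod q) = n := by
      refine orderOf_eq_prime h1 fun h17 => hq2 ?_
      have h16 : ((16 : ℕ) : ZMod q) = 0 := by
        push_cast; linear_combination h17
      rw [ZMod.natCast_eq_zero_iff] at h16
      exact (Nat.prime_dvd_prime_iff_eq hq Nat.prime_two).1
        (hq.dvd_of_dvd_pow (n := 4) (by simpa using h16))
    rw [← hord]
    exact orderOf_dvd_of_pow_eq_one (ZMod.pow_card_sub_one_eq_one h17)
  set y := q ^ s with hydef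
  have hy1 : 1 < y := Nat.one_lt_pow hs hq.one_lt
  have hyn : n ∣ y - 1 := hqn.trans (Nat.sub_one_dvd_pow_sub_one q s)
  have hyodd : Odd y := (hq.odd_of_ne_two hq2).pow
  have hy17 : 17 ∣ y - 1 := by
    have : Fact (Nat.Prime 17) := ⟨by norm_num⟩
    have h1 : (y : ZMod 17) ^ r = 1 := by
      have := congrArg (Nat.cast : ℕ → ZMod 17) h'
      push_cast at this
      rw [show (17 : ZMod 17) = 0 from rfl, zero_pow hn.ne_zero] at this
      have h16 : (16 : ZMod 17) = -1 := rfl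
      rw [h16] at this
      linear_combination this
    have h0 : (y : ZMod 17) ≠ 0 := by
      intro h0; rw [h0, zero_pow hr.ne_zero] at h1; exact zero_ne_one h1
    have h2 : (y : ZMod 17) ^ 16 = 1 := ZMod.pow_card_sub_one_eq_one h0
    have hcop : Nat.Coprime r 16 := by
      have : Nat.Coprime r 2 := hrodd.coprime_two_right
      simpa using this.pow_right 4
    have h3 : (y : ZMod 17) = 1 := by
      have := orderOf_dvd_of_pow_eq_one h1
      have := Nat.eq_one_of_dvd_coprimes hcop this (orderOf_dvd_of_pow_eq_one h2)
      exact orderOf_eq_one_iff.1 this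
    rw [← ZMod.natCast_eq_zero_iff, Nat.cast_sub hy1.le, h3]
    simp
  have hr17 : r ≠ 17 := by
    rintro rfl
    obtain ⟨c, hc⟩ := hy17
    have hyc : y = 1 + 17 * c := by omega
    have h1 : y ^ 17 ≡ 1 [MOD 289] := by
      have hz : (289 : ℤ) ∣ (y : ℤ) ^ 17 - 1 ^ 17 := by
        have := dvd_sub_pow_of_dvd_sub (R := ℤ) (p := 17) (a := y) (b := 1)
          (by rw [hyc]; push_cast; exact ⟨c, by ring⟩) 1
        simpa using this
      refine (Nat.modEq_iff_dvd' (Nat.one_le_pow _ _ (by omega))).2 ?_ |>.symm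
      zify [Nat.one_le_pow 17 y (by omega)]
      simpa using hz
    have h2 : 289 ∣ 17 ^ n := by
      rw [show 289 = 17 ^ 2 by norm_num]; exact pow_dvd_pow _ hn.two_le
    have : y ^ 17 % 289 = 1 := h1
    omega
  have hy18 : 18 ≤ y := by
    have := Nat.le_of_dvd (by omega) hy17; omega
  have hnr : r < n := by
    have h1 : 17 ^ r < 17 ^ n := by
      have := Nat.pow_le_pow_left (show 17 ≤ y by omega) r
      have := pow_pos (show 0 < 17 by norm_num) r
      omega
    exact (Nat.pow_lt_pow_iff_right (by norm_num)).1 h1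
  refine false_of_seventeen_pow_eq hr hr2 hr17 hn hnr ?_ hy1 (fun hn17 => ?_) h'
  · obtain ⟨c, hc⟩ := hy17
    exact ⟨c, by omega⟩
  · have h2 : 2 ∣ y - 1 := by
      obtain ⟨c, hc⟩ := hyodd
      exact ⟨c, by omega⟩
    have h34 : 34 ∣ y - 1 :=
      Nat.Coprime.mul_dvd_of_dvd_of_dvd (by norm_num : Nat.Coprime 2 17) h2 hy17
    have hc : Nat.Coprime 34 n := by
      rw [show 34 = 2 * 17 by norm_num]
      refine Nat.Coprime.mul_left ?_ ?_
      · exact (Nat.coprime_primes Nat.prime_two hn).2 (Ne.symm hn2)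
      · exact (Nat.coprime_primes (by norm_num) hn).2 (Ne.symm hn17)
    have := Nat.le_of_dvd (by omega) (hc.mul_dvd_of_dvd_of_dvd h34 hyn)
    omega

/-- There are no integers `p, l` with `|p|`, `|l|` prime, a prime `n`, and
naturals `m > 1`, `t > 0` such that `16·p^m + 1 = (l^t)^n`. -/
theorem no_solutions_sixteen_pow_add_one (p l : ℤ) (m t n : ℕ)
    (hp : p.natAbs.Prime) (hl : l.natAbs.Prime) (hn : n.Prime)
    (hm : 1 < m) (ht : 0 < t) :
    16 * p ^ m + 1 ≠ (l ^ t) ^ n := by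
  intro h
  by_cases hn2 : n = 2
  · subst hn2
    exact sixteen_mul_pow_add_one_ne_sq hp hm _ h
  rcases eq_seventeen_of_sixteen_mul_pow_add_one_eq hp hn hn2 h with hy | hy
  · rw [hy] at h
    have h0 : 0 < p ^ m := by
      have : (17 : ℤ) ^ n ≥ 1 := one_le_pow₀ (by norm_num)
      have : p ^ m ≠ 0 := pow_ne_zero _ (by rintro rfl; exact Nat.not_prime_zero hp)
      omega
    refine seventeen_pow_ne_one_add_sixteen_mul_prime_pow hn hn2 hp hm ?_
    zify
    rw [← abs_pow, abs_of_pos h0, ← h]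
    ring
  · have h1 : l.natAbs ^ t = 15 := by
      rw [← Int.natAbs_pow, hy]; rfl
    have h3 : 3 ∣ l.natAbs := Nat.prime_three.dvd_of_dvd_pow (n := t) (by rw [h1]; norm_num)
    have h5 : 5 ∣ l.natAbs := Nat.prime_five.dvd_of_dvd_pow (n := t) (by rw [h1]; norm_num)
    have e3 := (Nat.prime_dvd_prime_iff_eq Nat.prime_three hl).1 h3
    have e5 := (Nat.prime_dvd_prime_iff_eq Nat.prime_five hl).1 h5
    omega
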